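/- arXiv:2107.11841 — 2 statements merged into one kernel-verified Lean document; each statement's English description precedes it below -/
import Mathlib

section
/- The model checking problem for MPL[E], monadic path logic extended with the equal-level predicate, is decidable: there is an algorithm that, given a finite Kripke structure K and a closed MPL[E] formula φ, decides whether K ⊨ φ. -/
/-!
STATEMENT 3: The model checking problem for MPL[E], monadic path logic
extended with the equal-level predicate, is decidable: there is an algorithm
that, given a finite Kripke structure K and a closed MPL[E] formula φ,
decides whether K ⊨ φ.
-/

/-- A finite Kripke structure: finitely many states `Fin n`, an initial state,
a transition function with nonempty successor sets, and a state labeling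
(extended to nonempty finite state sequences by evaluating the last state). -/
structure FinKripke where
  n : ℕ
  init : Fin n
  trans : Fin n → Finset (Fin n)
  trans_nonempty : ∀ s, (trans s).Nonempty
  label : Fin n → Finset ℕ

/-- Paths of `K` starting in the initial state. -/
def FinKripke.IsPath (K : FinKripke) (p : ℕ → Fin K.n) : Prop :=
  p 0 = K.init ∧ ∀ i, p (i + 1) ∈ K.trans (p i)

/-- `l` is a finite prefix of a path of `K` starting in the initial state. -/
def FinKripke.IsPathPrefix (K : FinKripke) (l : List (Fin K.n)) : Prop :=
  ∃ p : ℕ → Fin K.n, K.IsPath p ∧ l = (List.range l.length).map p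

/-- The (prefix-closed) set of all finite prefixes of the path `p`. -/
def FinKripke.PrefixSet (K : FinKripke) (p : ℕ → Fin K.n) :
    Set (List (Fin K.n)) :=
  { l | l = (List.range l.length).map p }

/-- The labeling of a finite state sequence: the label of its last state. -/
def FinKripke.seqLabel (K : FinKripke) (l : List (Fin K.n)) : Set ℕ :=
  match l.getLast? with
  | some s => ((K.label s : Finset ℕ) : Set ℕ)
  | none => ∅

/-- MPL[E] formulas:
`P_a(x) | x < y | x = y | x ∈ X | E(x,y) | ¬φ | φ ∨ φ | ∃x.φ | ∃X.φ`. -/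
inductive MPLE : Type
  | patom : ℕ → ℕ → MPLE         -- `P_a(x)`
  | lt : ℕ → ℕ → MPLE            -- `x < y` (proper prefix)
  | eq : ℕ → ℕ → MPLE            -- `x = y`
  | mem : ℕ → ℕ → MPLE           -- `x ∈ X`
  | eqlevel : ℕ → ℕ → MPLE       -- `E(x, y)`
  | not : MPLE → MPLE
  | or : MPLE → MPLE → MPLE
  | exFO : ℕ → MPLE → MPLE       -- `∃x.φ`
  | exSO : ℕ → MPLE → MPLE       -- `∃X.φ`

/-- Satisfaction `K, V₁, V₂ ⊨ φ`: first-order variables are assigned finite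
prefixes of paths of `K` starting in the initial state, second-order variables
the prefix-closed sets of prefixes of full paths of `K`. -/
def MPLE.Sat (K : FinKripke) :
    (ℕ → List (Fin K.n)) → (ℕ → Set (List (Fin K.n))) → MPLE → Prop
  | V₁, _, .patom a x => a ∈ K.seqLabel (V₁ x)
  | V₁, _, .lt x y => V₁ x <+: V₁ y ∧ V₁ x ≠ V₁ y
  | V₁, _, .eq x y => V₁ x = V₁ y
  | V₁, V₂, .mem x X => V₁ x ∈ V₂ X
  | V₁, _, .eqlevel x y => (V₁ x).length = (V₁ y).length
  | V₁, V₂, .not φ => ¬ MPLE.Sat K V₁ V₂ φ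
  | V₁, V₂, .or φ₁ φ₂ => MPLE.Sat K V₁ V₂ φ₁ ∨ MPLE.Sat K V₁ V₂ φ₂
  | V₁, V₂, .exFO x φ =>
      ∃ l : List (Fin K.n), K.IsPathPrefix l ∧
        MPLE.Sat K (Function.update V₁ x l) V₂ φ
  | V₁, V₂, .exSO X φ =>
      ∃ p : ℕ → Fin K.n, K.IsPath p ∧
        MPLE.Sat K V₁ (Function.update V₂ X (K.PrefixSet p)) φ

/-- Free first-order variables. -/
def MPLE.freeFO : MPLE → Finset ℕ
  | .patom _ x => {x}
  | .lt x y => {x, y}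
  | .eq x y => {x, y}
  | .mem x _ => {x}
  | .eqlevel x y => {x, y}
  | .not φ => φ.freeFO
  | .or φ₁ φ₂ => φ₁.freeFO ∪ φ₂.freeFO
  | .exFO x φ => φ.freeFO \ {x}
  | .exSO _ φ => φ.freeFO

/-- Free second-order variables. -/
def MPLE.freeSO : MPLE → Finset ℕ
  | .patom _ _ => ∅
  | .lt _ _ => ∅
  | .eq _ _ => ∅
  | .mem _ X => {X}
  | .eqlevel _ _ => ∅
  | .not φ => φ.freeSO
  | .or φ₁ φ₂ => φ₁.freeSO ∪ φ₂.freeSO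
  | .exFO _ φ => φ.freeSO
  | .exSO X φ => φ.freeSO \ {X}

/-- A closed MPL[E] formula. -/
def MPLE.Closed (φ : MPLE) : Prop := φ.freeFO = ∅ ∧ φ.freeSO = ∅

/-- `K ⊨ φ` for closed `φ` (the valuations are irrelevant for closed
formulas). -/
def FinKripke.Models (K : FinKripke) (φ : MPLE) : Prop :=
  MPLE.Sat K (fun _ => ([] : List (Fin K.n))) (fun _ => (∅ : Set (List (Fin K.n)))) φ

/-- An explicit (injective) numerical encoding of MPL[E] formulas. -/
def MPLE.enc : MPLE → ℕ
  | .patom a x => Nat.pair 0 (Nat.pair a x)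
  | .lt x y => Nat.pair 1 (Nat.pair x y)
  | .eq x y => Nat.pair 2 (Nat.pair x y)
  | .mem x X => Nat.pair 3 (Nat.pair x X)
  | .eqlevel x y => Nat.pair 4 (Nat.pair x y)
  | .not φ => Nat.pair 5 φ.enc
  | .or φ₁ φ₂ => Nat.pair 6 (Nat.pair φ₁.enc φ₂.enc)
  | .exFO x φ => Nat.pair 7 (Nat.pair x φ.enc)
  | .exSO X φ => Nat.pair 8 (Nat.pair X φ.enc)

/-- An explicit (injective) numerical encoding of finite Kripke structures. -/
def FinKripke.enc (K : FinKripke) : ℕ :=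
  Nat.pair K.n (Nat.pair K.init.val (Nat.pair
    (Encodable.encode
      ((List.finRange K.n).map fun s => ((K.trans s).sort (· ≤ ·)).map Fin.val))
    (Encodable.encode
      ((List.finRange K.n).map fun s => (K.label s).sort (· ≤ ·)))))

namespace MC

/-- The segment of `w` between positions `a` (included) and `b` (excluded). -/
def seg {A : Type} (w : ℕ → A) (a b : ℕ) : List A :=
  (List.range (b - a)).map fun i => w (a + i)

lemma seg_length {A : Type} (w : ℕ → A) (a b : ℕ) : (seg w a b).length = b - a := by
  simp [seg]

lemma seg_append {A : Type} (w : ℕ → A) {a b c : ℕ} (h : a ≤ b) (h' : b ≤ c) :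
    seg w a b ++ seg w b c = seg w a c := by
  have : c - a = (b - a) + (c - b) := by omega
  unfold seg
  rw [this, List.range_add, List.map_append, List.map_map]
  congr 1
  apply List.map_congr_left
  intro i _
  simp only [Function.comp]
  congr 1
  omega

lemma seg_congr {A : Type} (w w' : ℕ → A) {a b a' b' : ℕ} (hl : b - a = b' - a')
    (h : ∀ i, i < b - a → w (a + i) = w' (a' + i)) : seg w a b = seg w' a' b' := by
  unfold seg
  rw [← hl]
  apply List.map_congr_left
  intro i hi
  exact h i (by simpa using hi)

/-- `L` is recognized by a finite quotient of size at most `M`. -/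
def Recog {A : Type} (L : (ℕ → A) → Prop) (M : ℕ) : Prop :=
  ∃ (S : Type) (_ : Fintype S) (τ : List A → S), Fintype.card S ≤ M ∧
    (∀ u u' v v', τ u = τ u' → τ v = τ v' → τ (u ++ v) = τ (u' ++ v')) ∧
    ∀ (w w' : ℕ → A) (g g' : ℕ → ℕ), StrictMono g → StrictMono g' → g 0 = 0 → g' 0 = 0 →
      (∀ k, τ (seg w (g k) (g (k + 1))) = τ (seg w' (g' k) (g' (k + 1)))) → L w → L w'

lemma Recog.mono {A : Type} {L : (ℕ → A) → Prop} {M M' : ℕ} (h : Recog L M) (hM : M ≤ M') :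
    Recog L M' := by
  obtain ⟨S, i, τ, h1, h2, h3⟩ := h
  exact ⟨S, i, τ, h1.trans hM, h2, h3⟩

lemma Recog.congr {A : Type} {L L' : (ℕ → A) → Prop} {M : ℕ} (h : Recog L M)
    (hL : ∀ w, L w ↔ L' w) : Recog L' M := by
  have : L = L' := funext fun w => propext (hL w)
  exact this ▸ h

lemma Recog.not {A : Type} {L : (ℕ → A) → Prop} {M : ℕ} (h : Recog L M) :
    Recog (fun w => ¬ L w) M := by
  obtain ⟨S, i, τ, h1, h2, h3⟩ := h
  refine ⟨S, i, τ, h1, h2, ?_⟩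
  intro w w' g g' hg hg' h0 h0' he hn hl
  exact hn (h3 w' w g' g hg' hg h0' h0 (fun k => (he k).symm) hl)

lemma Recog.and {A : Type} {L L' : (ℕ → A) → Prop} {M M' : ℕ} (h : Recog L M)
    (h' : Recog L' M') : Recog (fun w => L w ∧ L' w) (M * M') := by
  obtain ⟨S, i, τ, h1, h2, h3⟩ := h
  obtain ⟨S', i', τ', h1', h2', h3'⟩ := h'
  refine ⟨S × S', inferInstance, fun u => (τ u, τ' u), ?_, ?_, ?_⟩
  · rw [Fintype.card_prod]; exact Nat.mul_le_mul h1 h1'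
  · intro u u' v v' ha hb
    simp only [Prod.mk.injEq] at *
    exact ⟨h2 _ _ _ _ ha.1 hb.1, h2' _ _ _ _ ha.2 hb.2⟩
  · intro w w' g g' hg hg' h0 h0' he hl
    simp only [Prod.mk.injEq] at he
    exact ⟨h3 w w' g g' hg hg' h0 h0' (fun k => (he k).1) hl.1,
      h3' w w' g g' hg hg' h0 h0' (fun k => (he k).2) hl.2⟩

lemma block {g : ℕ → ℕ} (hg : StrictMono g) (h0 : g 0 = 0) (i : ℕ) :
    ∃ k, g k ≤ i ∧ i < g (k + 1) := by
  induction i with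
  | zero => exact ⟨0, by omega, by have := hg (Nat.lt_succ_self 0); simp at this ⊢; omega⟩
  | succ i ih =>
    obtain ⟨k, h1, h2⟩ := ih
    by_cases h : i + 1 < g (k + 1)
    · exact ⟨k, by omega, h⟩
    · exact ⟨k + 1, by omega, by have := hg (Nat.lt_succ_self (k + 1)); simp at this ⊢; omega⟩

lemma glue {B : Type} {g : ℕ → ℕ} (hg : StrictMono g) (h0 : g 0 = 0) (b : ℕ → ℕ → B) :
    ∃ y : ℕ → B, ∀ k j, g k + j < g (k + 1) → y (g k + j) = b k j := by
  choose K hK using block hg h0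
  refine ⟨fun i => b (K i) (i - g (K i)), ?_⟩
  intro k j hj
  have h := hK (g k + j)
  have e : K (g k + j) = k := by
    have h1 : K (g k + j) < k + 1 := hg.lt_iff_lt.1 (by omega)
    have h2 : k < K (g k + j) + 1 := hg.lt_iff_lt.1 (by omega)
    omega
  simp only [e]
  congr 1
  omega

lemma isChain_seg {F : Type} (R : F → F → Prop) (w : ℕ → F) (a b : ℕ) :
    (seg w a b).IsChain R ↔ ∀ i, a ≤ i → i + 1 < b → R (w i) (w (i + 1)) := by
  rw [List.isChain_iff_getElem]
  simp only [seg_length]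
  constructor
  · intro h i hi hb
    have := h (i - a) (by omega)
    simp only [seg, List.getElem_map, List.getElem_range] at this
    rwa [show a + (i - a) = i by omega, show a + (i - a + 1) = i + 1 by omega] at this
  · intro h i hi
    simp only [seg, List.getElem_map, List.getElem_range]
    exact h (a + i) (by omega) (by omega)

lemma head_seg {F : Type} (w : ℕ → F) {a b : ℕ} (h : a < b) :
    (seg w a b).head? = some (w a) := by
  rw [List.head?_eq_getElem?]
  simp [seg, h]

lemma last_seg {F : Type} (w : ℕ → F) {a b : ℕ} (h : a < b) :
    (seg w a b).getLast? = some (w (b - 1)) := by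
  rw [List.getLast?_eq_getElem?]
  rw [seg_length]
  unfold seg
  rw [List.getElem?_map, List.getElem?_range (by omega)]
  simp only [Option.map_some]
  congr 2
  omega

lemma map_seg {A F : Type} (f : A → F) (w : ℕ → A) (a b : ℕ) :
    (seg w a b).map f = seg (fun i => f (w i)) a b := by
  simp [seg]

open Classical in
/-- Local properties are recognizable. -/
lemma recog_local {A F : Type} [Fintype F] (f : A → F) (R0 : F → Prop) (R : F → F → Prop) :
    Recog (fun w : ℕ → A => R0 (f (w 0)) ∧ ∀ i, R (f (w i)) (f (w (i + 1))))
      ((Fintype.card F + 1) * ((Fintype.card F + 1) * 2)) := by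
  refine ⟨Option F × Option F × Prop, inferInstance, fun u =>
    ((u.map f).head?, (u.map f).getLast?, (u.map f).IsChain R), ?_, ?_, ?_⟩
  · simp [Fintype.card_prod]
  · intro u u' v v' h1 h2
    simp only [Prod.mk.injEq, List.map_append, List.head?_append, List.getLast?_append,
      List.isChain_append] at *
    obtain ⟨a1, a2, a3⟩ := h1
    obtain ⟨b1, b2, b3⟩ := h2
    rw [a1, a2, a3, b1, b2, b3]
    exact ⟨rfl, rfl, rfl⟩
  · intro w w' g g' hg hg' h0 h0' he hl
    simp only [Prod.mk.injEq, map_seg, eq_iff_iff] at he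
    have hlt : ∀ k, g k < g (k + 1) := fun k => hg (Nat.lt_succ_self k)
    have hlt' : ∀ k, g' k < g' (k + 1) := fun k => hg' (Nat.lt_succ_self k)
    have e1 : ∀ k, f (w (g k)) = f (w' (g' k)) := by
      intro k
      have := (he k).1
      rw [head_seg _ (hlt k), head_seg _ (hlt' k)] at this
      simpa using this
    have e2 : ∀ k, f (w (g (k + 1) - 1)) = f (w' (g' (k + 1) - 1)) := by
      intro k
      have := (he k).2.1
      rw [last_seg _ (hlt k), last_seg _ (hlt' k)] at this
      simpa using this
    refine ⟨?_, ?_⟩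
    · have := e1 0
      rw [h0, h0'] at this
      rw [← this]; exact hl.1
    · intro i
      obtain ⟨k, k1, k2⟩ := block hg' h0' i
      by_cases hi : i + 1 < g' (k + 1)
      · have h3 := (he k).2.2
        rw [isChain_seg, isChain_seg] at h3
        exact h3.1 (fun j _ _ => hl.2 j) i k1 hi
      · have hi' : g' (k + 1) = i + 1 := by omega
        have a1 := e1 (k + 1)
        have a2 := e2 k
        rw [hi'] at a1 a2
        simp only [Nat.add_sub_cancel] at a2
        rw [← a1, ← a2]
        have := hl.2 (g (k + 1) - 1)
        have h4 := hlt k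
        rwa [show g (k + 1) - 1 + 1 = g (k + 1) by omega] at this

/-- Replace track `x` of the word `w` by `y`. -/
def updW {B : Type} (w : ℕ → ℕ → B) (x : ℕ) (y : ℕ → B) : ℕ → ℕ → B :=
  fun i => Function.update (w i) x (y i)

/-- Replace track `x` of a finite word. -/
def updL {B : Type} (u : List (ℕ → B)) (x : ℕ) (y : ℕ → B) : List (ℕ → B) :=
  u.mapIdx fun i a => Function.update a x (y i)

lemma seg_updW {B : Type} (w : ℕ → ℕ → B) (x : ℕ) (y : ℕ → B) (a b : ℕ) :
    seg (updW w x y) a b = updL (seg w a b) x (fun j => y (a + j)) := by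
  apply List.ext_getElem
  · simp [seg_length, updL]
  · intro i h1 h2
    simp [seg, updL, updW]

lemma updL_congr {B : Type} (u : List (ℕ → B)) (x : ℕ) {y y' : ℕ → B}
    (h : ∀ i, i < u.length → y i = y' i) : updL u x y = updL u x y' := by
  apply List.ext_getElem
  · simp [updL]
  · intro i h1 h2
    simp only [updL, List.length_mapIdx] at h1
    simp [updL, h i h1]

lemma updL_append {B : Type} (u v : List (ℕ → B)) (x : ℕ) (y : ℕ → B) :
    updL (u ++ v) x y = updL u x y ++ updL v x (fun i => y (i + u.length)) := by
  simp [updL, List.mapIdx_append]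

open Classical in
/-- Recognizable properties are closed under projection. -/
lemma Recog.proj {B : Type} {L : (ℕ → ℕ → B) → Prop} {M : ℕ} (h : Recog L M) (x : ℕ) :
    Recog (fun w => ∃ y, L (updW w x y)) (2 ^ M) := by
  obtain ⟨S, i, τ, h1, h2, h3⟩ := h
  refine ⟨Set S, inferInstance, fun u => {s | ∃ y, τ (updL u x y) = s}, ?_, ?_, ?_⟩
  · rw [Fintype.card_set]
    exact Nat.pow_le_pow_right (by norm_num) h1
  · have key : ∀ u u' v v' : List (ℕ → B),
        {s | ∃ y, τ (updL u x y) = s} = {s | ∃ y, τ (updL u' x y) = s} →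
        {s | ∃ y, τ (updL v x y) = s} = {s | ∃ y, τ (updL v' x y) = s} →
        {s | ∃ y, τ (updL (u ++ v) x y) = s} ⊆ {s | ∃ y, τ (updL (u' ++ v') x y) = s} := by
      rintro u u' v v' hu hv s ⟨y, rfl⟩
      have a1 : τ (updL u x y) ∈ {s | ∃ y, τ (updL u' x y) = s} := by
        rw [← hu]; exact ⟨_, rfl⟩
      have a2 : τ (updL v x (fun i => y (i + u.length))) ∈ {s | ∃ y, τ (updL v' x y) = s} := by
        rw [← hv]; exact ⟨_, rfl⟩
      obtain ⟨y1, hy1⟩ := a1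
      obtain ⟨y2, hy2⟩ := a2
      refine ⟨fun i => if i < u'.length then y1 i else y2 (i - u'.length), ?_⟩
      rw [updL_append, updL_append]
      apply h2
      · rw [← hy1]
        congr 1
        apply updL_congr
        intro i hi
        simp [hi]
      · rw [← hy2]
        congr 1
        apply updL_congr
        intro i hi
        simp
    intro u u' v v' hu hv
    exact Set.Subset.antisymm (key u u' v v' hu hv) (key u' u v' v hu.symm hv.symm)
  · rintro w w' g g' hg hg' h0 h0' he ⟨y, hy⟩
    have : ∀ k, ∃ b : ℕ → B, τ (updL (seg w' (g' k) (g' (k + 1))) x b) =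
        τ (seg (updW w x y) (g k) (g (k + 1))) := by
      intro k
      have : τ (seg (updW w x y) (g k) (g (k + 1))) ∈
          {s | ∃ y, τ (updL (seg w (g k) (g (k + 1))) x y) = s} := by
        rw [seg_updW]; exact ⟨_, rfl⟩
      have h5 := he k
      simp only at h5
      rw [h5] at this
      exact this
    choose b hb using this
    obtain ⟨y', hy'⟩ := glue hg' h0' b
    refine ⟨y', h3 _ _ g g' hg hg' h0 h0' ?_ hy⟩
    intro k
    rw [← hb k, seg_updW]
    congr 1
    apply updL_congr
    intro i hi
    rw [seg_length] at hi
    rw [hy' k i (by omega)]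

/-- Ramsey's theorem for pairs. -/
lemma ramsey {S : Type} [Finite S] (c : ℕ → ℕ → S) :
    ∃ (k : ℕ → ℕ) (e : S), StrictMono k ∧ ∀ i j, i < j → c (k i) (k j) = e := by
  have hU : ∀ f : ℕ → S, ∃ s, ∀ᶠ j in (Filter.hyperfilter ℕ : Filter ℕ), f j = s := by
    intro f
    by_contra hcon
    simp only [not_exists, ← Ultrafilter.eventually_not] at hcon
    have : ∀ s, ∀ᶠ j in (Filter.hyperfilter ℕ : Filter ℕ), f j ≠ s := hcon
    rw [← Filter.eventually_all] at this
    obtain ⟨j, hj⟩ := this.exists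
    exact hj (f j) rfl
  choose d hd using fun i => hU (c i)
  obtain ⟨e, he⟩ := hU d
  obtain ⟨k, _, hk⟩ := exists_seq_of_forall_finset_exists (fun i => d i = e)
    (fun i j => i < j ∧ c i j = e) (by
      intro s hs
      have h1 : ∀ᶠ j in (Filter.hyperfilter ℕ : Filter ℕ), ∀ x ∈ s, x < j ∧ c x j = e := by
        rw [Filter.eventually_all_finset]
        intro x hx
        have h2 : ∀ᶠ j in (Filter.hyperfilter ℕ : Filter ℕ), x < j := by
          apply Filter.hyperfilter_le_cofinite
          rw [Nat.cofinite_eq_atTop]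
          exact Filter.eventually_gt_atTop x
        have h3 := hd x
        rw [hs x hx] at h3
        exact h2.and h3
      exact (he.and h1).exists)
  exact ⟨k, e, fun i j hij => (hk i j hij).1, fun i j hij => (hk i j hij).2⟩

lemma per_mul {A : Type} {w : ℕ → A} {p q : ℕ} (hper : ∀ i, p ≤ i → w (i + q) = w i) (m : ℕ) :
    ∀ i, p ≤ i → w (i + m * q) = w i := by
  induction m with
  | zero => simp
  | succ m ih =>
    intro i hi
    rw [Nat.succ_mul, ← Nat.add_assoc, hper _ (by omega), ih i hi]

/-- Pumping down. -/
lemma shorten {B S : Type} [Fintype S] (τ : List (ℕ → B) → S)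
    (h2 : ∀ u u' v v', τ u = τ u' → τ v = τ v' → τ (u ++ v) = τ (u' ++ v'))
    (x : ℕ) (w : ℕ → ℕ → B) (p q a : ℕ) (ha : a ≤ p)
    (hper : ∀ i, p ≤ i → w (i + q) = w i) (s : S) :
    ∀ (k : ℕ) (y : ℕ → B), 0 < k → τ (seg (updW w x y) a (p + k * q)) = s →
    ∃ (k' : ℕ) (y' : ℕ → B), 0 < k' ∧ k' ≤ Fintype.card S ∧
      τ (seg (updW w x y') a (p + k' * q)) = s := by
  intro k
  induction k using Nat.strong_induction_on with
  | _ k ih =>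
    intro y hk hs
    by_cases hc : k ≤ Fintype.card S
    · exact ⟨k, y, hk, hc, hs⟩
    · obtain ⟨i, j, hij, he⟩ : ∃ i j : Fin k, i < j ∧
          τ (seg (updW w x y) a (p + (i.val + 1) * q)) =
          τ (seg (updW w x y) a (p + (j.val + 1) * q)) := by
        obtain ⟨i, j, hne, he⟩ := Fintype.exists_ne_map_eq_of_card_lt
          (fun i : Fin k => τ (seg (updW w x y) a (p + (i.val + 1) * q))) (by simp; omega)
        rcases lt_or_gt_of_ne hne with h | h
        · exact ⟨i, j, h, he⟩
        · exact ⟨j, i, h, he.symm⟩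
      have hij' : i.val < j.val := hij
      have hjk := j.isLt
      obtain ⟨d, hd⟩ : ∃ d, j.val = i.val + d := ⟨j.val - i.val, by omega⟩
      obtain ⟨r, hr⟩ : ∃ r, k = j.val + 1 + r := ⟨k - (j.val + 1), by omega⟩
      -- positions
      have e1 : p + k * q = p + (i.val + 1 + r) * q + d * q := by
        have hk' : k = i.val + d + 1 + r := by omega
        have := congrArg (fun z => p + z * q) hk'
        rw [this]; ring
      have e2 : p + (j.val + 1) * q = p + (i.val + 1) * q + d * q := by rw [hd]; ring
      have e3 : p + (i.val + 1 + r) * q = p + (i.val + 1) * q + r * q := by ring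
      have e4 : a ≤ p + (i.val + 1) * q := by omega
      apply ih (i.val + 1 + r) (by omega)
        (fun l => if l < p + (i.val + 1) * q then y l else y (l + d * q)) (by omega)
      rw [← hs, ← seg_append _ e4 (show p + (i.val + 1) * q ≤ p + (i.val + 1 + r) * q by omega),
        ← seg_append (updW w x y) (show a ≤ p + (j.val + 1) * q by omega)
          (show p + (j.val + 1) * q ≤ p + k * q by omega)]
      apply h2
      · rw [← he]
        congr 1
        apply seg_congr _ _ rfl
        intro l hl
        simp only [updW]
        rw [if_pos (by omega)]
      · congr 1
        apply seg_congr _ _ (by omega)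
        intro l hl
        simp only [updW]
        rw [if_neg (by omega), e2,
          show p + (i.val + 1) * q + d * q + l = p + (i.val + 1) * q + l + d * q by ring,
          per_mul hper d _ (by omega)]

/-- An existential quantifier over tracks of an ultimately periodic word has a small ultimately
periodic witness. -/
theorem bounded_witness {B : Type} {L : (ℕ → ℕ → B) → Prop} {M : ℕ} (hL : Recog L M) (x : ℕ)
    (w : ℕ → ℕ → B) (p q : ℕ) (hq : 0 < q) (hper : ∀ i, p ≤ i → w (i + q) = w i)
    (y : ℕ → B) (h : L (updW w x y)) :
    ∃ (y' : ℕ → B) (p' q' : ℕ), p' ≤ p + M * q ∧ 0 < q' ∧ q' ≤ M * q ∧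
      (∀ i, p' ≤ i → y' (i + q') = y' i) ∧ L (updW w x y') := by
  obtain ⟨S, inst, τ, h1, h2, h3⟩ := hL
  obtain ⟨k, e, hk, hc⟩ := ramsey fun i j => τ (seg (updW w x y) (p + i * q) (p + j * q))
  have hk1 : 0 < k 1 := lt_of_le_of_lt (Nat.zero_le _) (hk Nat.zero_lt_one)
  obtain ⟨a, y1, ha, haM, hy1⟩ := shorten τ h2 x w p q 0 (Nat.zero_le _) hper _ (k 1) y hk1 rfl
  obtain ⟨d, hd⟩ : ∃ d, k 2 = k 1 + d := ⟨k 2 - k 1, by have := hk (show 1 < 2 by norm_num); omega⟩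
  have hd0 : 0 < d := by have := hk (show 1 < 2 by norm_num); omega
  have he : τ (seg (updW w x (fun l => y (l + k 1 * q))) p (p + d * q)) = e := by
    rw [← hc 1 2 (by norm_num), hd]
    congr 1
    apply seg_congr
    · rw [Nat.add_mul]; omega
    · intro l hl
      simp only [updW]
      rw [show p + k 1 * q + l = p + l + k 1 * q by ring, per_mul hper _ _ (by omega)]
  obtain ⟨b, y2, hb, hbM, hy2⟩ := shorten τ h2 x w p q p le_rfl hper _ d _ hd0 he
  have hbq : 0 < b * q := Nat.mul_pos hb hq
  have haq : 0 < a * q := Nat.mul_pos ha hq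
  refine ⟨fun i => if i < p + a * q then y1 i else y2 (p + (i - (p + a * q)) % (b * q)),
    p + a * q, b * q, ?_, hbq, ?_, ?_, ?_⟩
  · have := Nat.mul_le_mul_right q (haM.trans h1); omega
  · exact Nat.mul_le_mul_right q (hbM.trans h1)
  · intro i hi
    simp only
    rw [if_neg (by omega), if_neg (by omega),
      show i + b * q - (p + a * q) = i - (p + a * q) + b * q by omega, Nat.add_mod_right]
  · refine h3 (updW w x y) _ (fun j => if j = 0 then 0 else p + k j * q)
      (fun j => if j = 0 then 0 else p + a * q + (j - 1) * (b * q)) ?_ ?_ rfl rfl ?_ h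
    · apply strictMono_nat_of_lt_succ
      intro j
      have h4 : k j < k (j + 1) := hk (Nat.lt_succ_self j)
      have h5 := Nat.mul_lt_mul_of_pos_right h4 hq
      by_cases hj : j = 0
      · subst hj; simp; right; exact ⟨hk1, hq⟩
      · simp [hj]; exact h5
    · apply strictMono_nat_of_lt_succ
      intro j
      by_cases hj : j = 0
      · subst hj; simp; right; exact ⟨ha, hq⟩
      · obtain ⟨j', rfl⟩ : ∃ j', j = j' + 1 := ⟨j - 1, by omega⟩
        simp only [Nat.succ_ne_zero, if_false, Nat.add_sub_cancel]
        rw [Nat.add_mul]; omega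
    · intro j
      by_cases hj : j = 0
      · subst hj
        simp only [if_true, Nat.zero_add, Nat.one_ne_zero, if_false, Nat.sub_self, Nat.zero_mul,
          Nat.add_zero]
        rw [← hy1]
        congr 1
        apply seg_congr _ _ rfl
        intro l hl
        simp only [updW]
        rw [if_pos (by omega)]
      · obtain ⟨j', rfl⟩ : ∃ j', j = j' + 1 := ⟨j - 1, by omega⟩
        simp only [Nat.succ_ne_zero, if_false, Nat.add_sub_cancel]
        rw [hc _ _ (Nat.lt_succ_self _), ← hy2]
        congr 1
        have e1 : (j' + 1) * (b * q) = j' * (b * q) + b * q := by ring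
        apply seg_congr
        · rw [e1]; omega
        · intro l hl
          simp only [updW]
          have hl' : l < b * q := by omega
          rw [if_neg (by omega),
            show p + a * q + j' * (b * q) + l - (p + a * q) = l + j' * (b * q) by omega,
            Nat.add_mul_mod_self_right, Nat.mod_eq_of_lt hl',
            show p + a * q + j' * (b * q) + l = p + l + (a + j' * b) * q by ring,
            per_mul hper _ _ (by omega)]

/-! ### Numerical data extracted from the code of a structure -/

def kn (kc : ℕ) : ℕ := kc.unpair.1
def kinit (kc : ℕ) : ℕ := kc.unpair.2.unpair.1
def klist (c : ℕ) : List (List ℕ) := (Encodable.decode (α := List (List ℕ)) c).getD []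
def ktrans (kc : ℕ) : List (List ℕ) := klist kc.unpair.2.unpair.2.unpair.1
def klabel (kc : ℕ) : List (List ℕ) := klist kc.unpair.2.unpair.2.unpair.2
/-- Transition relation; the state `s` is represented by `s + 1`. -/
def TR (kc a b : ℕ) : Prop := a ≠ 0 ∧ b ≠ 0 ∧ ∃ z ∈ (ktrans kc).getD (a - 1) [], z = b - 1
/-- Labels; the state `s` is represented by `s + 1`. -/
def LB (kc l a : ℕ) : Prop := a ≠ 0 ∧ ∃ z ∈ (klabel kc).getD (a - 1) [], z = l

/-! ### Atomic properties of tracks -/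

def Al (I : ℕ → Prop) (Q : ℕ → ℕ → ℕ → Prop) (x y : ℕ → ℕ) : Prop :=
  ∀ i, I i → Q (x i) (y i) (x (i + 1))

def qPat (kc a : ℕ) : ℕ → ℕ → ℕ → Prop := fun u _ u' => ¬ (LB kc a u ∧ u' = 0)
def qSub : ℕ → ℕ → ℕ → Prop := fun u v _ => u = 0 ∨ u = v
def qEq : ℕ → ℕ → ℕ → Prop := fun u v _ => u = v
def qLev : ℕ → ℕ → ℕ → Prop := fun u v _ => (u = 0 ∧ v = 0) ∨ (¬ u = 0 ∧ ¬ v = 0)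
def qPath (kc : ℕ) : ℕ → ℕ → ℕ → Prop := fun u _ u' => u' = 0 ∨ TR kc u u'
def qFin : ℕ → ℕ → ℕ → Prop := fun u _ _ => ¬ u = 0

/-- Atomic formulas. -/
def Atom (kc : ℕ) (I : ℕ → Prop) (W : ℕ → ℕ → ℕ) (tag a b : ℕ) : Prop :=
  (tag = 0 ∧ ¬ Al I (qPat kc a) (fun i => W i (2 * b)) (fun i => W i (2 * b))) ∨
  (tag = 1 ∧ Al I qSub (fun i => W i (2 * a)) (fun i => W i (2 * b)) ∧
    ¬ Al I qEq (fun i => W i (2 * a)) (fun i => W i (2 * b))) ∨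
  (tag = 2 ∧ Al I qEq (fun i => W i (2 * a)) (fun i => W i (2 * b))) ∨
  (tag = 3 ∧ Al I qSub (fun i => W i (2 * a)) (fun i => W i (2 * b + 1))) ∨
  (tag = 4 ∧ Al I qLev (fun i => W i (2 * a)) (fun i => W i (2 * b)))

/-- The track `x` represents a finite path prefix (`so = 0`) or an infinite path (`so ≠ 0`). -/
def Dom (kc : ℕ) (I : ℕ → Prop) (x : ℕ → ℕ) (so : ℕ) : Prop :=
  (x 0 = 0 ∨ x 0 = kinit kc + 1) ∧ Al I (qPath kc) x x ∧
    ((so = 0 ∧ ¬ Al I qFin x x) ∨ (¬ so = 0 ∧ Al I qFin x x))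

/-- Semantics over words. -/
def SatW (kc : ℕ) : (ℕ → ℕ → Fin (kn kc + 1)) → MPLE → Prop
  | w, .patom a x => Atom kc (fun _ => True) (fun i k => (w i k).val) 0 a x
  | w, .lt x y => Atom kc (fun _ => True) (fun i k => (w i k).val) 1 x y
  | w, .eq x y => Atom kc (fun _ => True) (fun i k => (w i k).val) 2 x y
  | w, .mem x X => Atom kc (fun _ => True) (fun i k => (w i k).val) 3 x X
  | w, .eqlevel x y => Atom kc (fun _ => True) (fun i k => (w i k).val) 4 x y
  | w, .not φ => ¬ SatW kc w φ
  | w, .or φ₁ φ₂ => SatW kc w φ₁ ∨ SatW kc w φ₂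
  | w, .exFO x φ => ∃ y : ℕ → Fin (kn kc + 1),
      Dom kc (fun _ => True) (fun i => (y i).val) 0 ∧ SatW kc (updW w (2 * x + 0) y) φ
  | w, .exSO x φ => ∃ y : ℕ → Fin (kn kc + 1),
      Dom kc (fun _ => True) (fun i => (y i).val) 1 ∧ SatW kc (updW w (2 * x + 1) y) φ

/-- Size of the recognizer of a local property. -/
def lsz (kc : ℕ) : ℕ :=
  ((kn kc + 1) * (kn kc + 1) + 1) * (((kn kc + 1) * (kn kc + 1) + 1) * 2)

lemma lsz_pos (kc : ℕ) : 0 < lsz kc := by unfold lsz; positivity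

/-- Bound for the size of the recognizer of a formula with code `k`. -/
def tw (kc k : ℕ) : ℕ := (fun m => 2 ^ (m * m))^[k] (lsz kc * lsz kc)

lemma tw_succ (kc k : ℕ) : tw kc (k + 1) = 2 ^ (tw kc k * tw kc k) := by
  simp only [tw, Function.iterate_succ_apply']

lemma sq_lt (m : ℕ) : m * m < 2 ^ (m * m) := Nat.lt_two_pow_self

lemma le_self_sq (m : ℕ) : m ≤ m * m := Nat.le_mul_self m

lemma tw_mono (kc : ℕ) : Monotone (tw kc) := by
  apply monotone_nat_of_le_succ
  intro k
  rw [tw_succ]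
  exact (le_self_sq _).trans (sq_lt _).le

lemma tw_base (kc k : ℕ) : lsz kc * lsz kc ≤ tw kc k := tw_mono kc (Nat.zero_le k)

lemma recog_Al (kc : ℕ) (Q : ℕ → ℕ → ℕ → Prop) (R0 : ℕ → Prop) (x y : ℕ) :
    Recog (fun w : ℕ → ℕ → Fin (kn kc + 1) => R0 (w 0 x).val ∧
      Al (fun _ => True) Q (fun i => (w i x).val) (fun i => (w i y).val)) (lsz kc) := by
  have := recog_local (A := ℕ → Fin (kn kc + 1)) (fun a => (a x, a y))
    (fun f => R0 f.1.val) (fun f f' => Q f.1.val f.2.val f'.1.val)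
  simp only [Fintype.card_prod, Fintype.card_fin] at this
  refine this.congr ?_
  intro w
  simp [Al]

lemma recog_Al' (kc : ℕ) (Q : ℕ → ℕ → ℕ → Prop) (x y : ℕ) :
    Recog (fun w : ℕ → ℕ → Fin (kn kc + 1) =>
      Al (fun _ => True) Q (fun i => (w i x).val) (fun i => (w i y).val)) (lsz kc) :=
  (recog_Al kc Q (fun _ => True) x y).congr (by simp)

lemma recog_Dom (kc : ℕ) (x so : ℕ) :
    Recog (fun w : ℕ → ℕ → Fin (kn kc + 1) =>
      Dom kc (fun _ => True) (fun i => (w i x).val) so) (lsz kc * lsz kc) := by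
  have h1 := recog_Al kc (qPath kc) (fun v => v = 0 ∨ v = kinit kc + 1) x x
  have h2 := recog_Al' kc qFin x x
  by_cases hs : so = 0
  · refine (h1.and h2.not).congr ?_
    intro w
    simp [Dom, hs, and_assoc]
  · refine (h1.and h2).congr ?_
    intro w
    simp [Dom, hs, and_assoc]

lemma recog_ex (kc : ℕ) (k so N : ℕ) (L : (ℕ → ℕ → Fin (kn kc + 1)) → Prop)
    (h : Recog L (tw kc N)) :
    Recog (fun w : ℕ → ℕ → Fin (kn kc + 1) =>
      Dom kc (fun _ => True) (fun i => (w i k).val) so ∧ L w) (tw kc N * tw kc N) :=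
  ((recog_Dom kc k so).and h).mono (Nat.mul_le_mul_right _ (tw_base kc N))

lemma updW_same {B : Type} (w : ℕ → ℕ → B) (k : ℕ) (y : ℕ → B) (i : ℕ) :
    updW w k y i k = y i := by simp [updW]

lemma enc_lt (t c : ℕ) (ht : 0 < t) : c < Nat.pair t c := by
  have := Nat.add_le_pair t c; omega

lemma enc_lt_l (t a c : ℕ) (ht : 0 < t) : a < Nat.pair t (Nat.pair a c) := by
  have := Nat.add_le_pair t (Nat.pair a c)
  have := Nat.left_le_pair a c
  omega

lemma enc_lt_r (t a c : ℕ) (ht : 0 < t) : c < Nat.pair t (Nat.pair a c) := by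
  have := Nat.add_le_pair t (Nat.pair a c)
  have := Nat.right_le_pair a c
  omega

theorem recog_SatW (kc : ℕ) (φ : MPLE) : Recog (fun w => SatW kc w φ) (tw kc φ.enc) := by
  have hl : ∀ k, lsz kc ≤ tw kc k := fun k => (le_self_sq _).trans (tw_base kc k)
  have hsq : ∀ k k', k < k' → tw kc k * tw kc k ≤ tw kc k' := fun k k' h =>
    ((sq_lt _).le.trans (tw_succ kc k).ge).trans (tw_mono kc h)
  have hpow : ∀ k k', k < k' → 2 ^ (tw kc k * tw kc k) ≤ tw kc k' := fun k k' h =>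
    (tw_succ kc k).ge.trans (tw_mono kc h)
  induction φ with
  | patom a x =>
    refine ((recog_Al' kc (qPat kc a) (2 * x) (2 * x)).not.mono (hl _)).congr ?_
    intro w; simp [SatW, Atom]
  | lt x y =>
    refine (((recog_Al' kc qSub (2 * x) (2 * y)).and
      (recog_Al' kc qEq (2 * x) (2 * y)).not).mono (tw_base _ _)).congr ?_
    intro w; simp [SatW, Atom]
  | eq x y =>
    refine ((recog_Al' kc qEq (2 * x) (2 * y)).mono (hl _)).congr ?_
    intro w; simp [SatW, Atom]
  | mem x y =>
    refine ((recog_Al' kc qSub (2 * x) (2 * y + 1)).mono (hl _)).congr ?_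
    intro w; simp [SatW, Atom]
  | eqlevel x y =>
    refine ((recog_Al' kc qLev (2 * x) (2 * y)).mono (hl _)).congr ?_
    intro w; simp [SatW, Atom]
  | not φ ih =>
    exact ih.not.mono (tw_mono kc (enc_lt 5 _ (by norm_num)).le)
  | or φ₁ φ₂ ih1 ih2 =>
    have h1 := ih1.mono (tw_mono kc (le_max_left φ₁.enc φ₂.enc))
    have h2 := ih2.mono (tw_mono kc (le_max_right φ₁.enc φ₂.enc))
    refine ((h1.not.and h2.not).not.mono (hsq _ _ ?_)).congr ?_
    · exact max_lt (enc_lt_l 6 _ _ (by norm_num)) (enc_lt_r 6 _ _ (by norm_num))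
    · intro w; simp only [SatW]; tauto
  | exFO x φ ih =>
    refine (((recog_ex kc (2 * x + 0) 0 _ _ ih).proj (2 * x + 0)).mono
      (hpow _ _ (enc_lt_r 7 _ _ (by norm_num)))).congr ?_
    intro w; simp only [SatW, updW_same]
  | exSO x φ ih =>
    refine (((recog_ex kc (2 * x + 1) 1 _ _ ih).proj (2 * x + 1)).mono
      (hpow _ _ (enc_lt_r 8 _ _ (by norm_num)))).congr ?_
    intro w; simp only [SatW, updW_same]

/-! ### Codes for ultimately periodic tracks -/

def tp (t : ℕ) : ℕ := t.unpair.1.unpair.1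
def tq (t : ℕ) : ℕ := t.unpair.1.unpair.2 + 1
def tval (n t i : ℕ) : ℕ :=
  (t.unpair.2 / (n + 1) ^ (if i < tp t then i else tp t + (i - tp t) % tq t)) % (n + 1)

lemma tval_lt (n t i : ℕ) : tval n t i < n + 1 := Nat.mod_lt _ (Nat.succ_pos n)

lemma tval_per (n t i : ℕ) (h : tp t ≤ i) : tval n t (i + tq t) = tval n t i := by
  unfold tval
  rw [if_neg (by omega), if_neg (by omega),
    show i + tq t - tp t = i - tp t + tq t by omega, Nat.add_mod_right]

lemma exists_digits (n : ℕ) (k : ℕ) : ∀ y : ℕ → Fin (n + 1), ∃ m, m < (n + 1) ^ k ∧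
    ∀ j, j < k → m / (n + 1) ^ j % (n + 1) = (y j).val := by
  induction k with
  | zero => intro y; exact ⟨0, by simp, by simp⟩
  | succ k ih =>
    intro y
    obtain ⟨m, hm, h⟩ := ih (fun i => y (i + 1))
    have h0 := (y 0).isLt
    refine ⟨(y 0).val + (n + 1) * m, ?_, ?_⟩
    · have : (n + 1) * (m + 1) ≤ (n + 1) * (n + 1) ^ k := Nat.mul_le_mul_left _ hm
      rw [pow_succ, mul_comm ((n + 1) ^ k)]
      rw [Nat.mul_add] at this
      omega
    · intro j hj
      cases j with
      | zero => simp [Nat.mod_eq_of_lt h0]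
      | succ j =>
        rw [pow_succ', ← Nat.div_div_eq_div_mul, Nat.add_mul_div_left _ _ (Nat.succ_pos n),
          Nat.div_eq_of_lt h0, Nat.zero_add]
        exact h j (by omega)

lemma exists_code (n N : ℕ) (y : ℕ → Fin (n + 1)) (p q : ℕ) (hp : p ≤ N) (hq : 0 < q)
    (hqN : q ≤ N) (hper : ∀ i, p ≤ i → y (i + q) = y i) :
    ∃ t, t < ((N + 1) ^ 2 + (n + 1) ^ (2 * N) + 1) ^ 2 ∧ ∀ i, tval n t i = (y i).val := by
  obtain ⟨m, hm, h⟩ := exists_digits n (p + q) y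
  refine ⟨Nat.pair (Nat.pair p (q - 1)) m, ?_, ?_⟩
  · refine (Nat.pair_lt_max_add_one_sq _ _).trans_le (Nat.pow_le_pow_left ?_ 2)
    have h1 := Nat.pair_lt_max_add_one_sq p (q - 1)
    have h2 : (max p (q - 1) + 1) ^ 2 ≤ (N + 1) ^ 2 := Nat.pow_le_pow_left (by omega) 2
    have h3 : (n + 1) ^ (p + q) ≤ (n + 1) ^ (2 * N) :=
      Nat.pow_le_pow_right (Nat.succ_pos n) (by omega)
    omega
  · intro i
    have e1 : tp (Nat.pair (Nat.pair p (q - 1)) m) = p := by simp [tp]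
    have e2 : tq (Nat.pair (Nat.pair p (q - 1)) m) = q := by simp [tq]; omega
    unfold tval
    rw [e1, e2]
    simp only [Nat.unpair_pair]
    split_ifs with hi
    · exact h i (by omega)
    · have := Nat.mod_lt (i - p) hq
      rw [h _ (by omega)]
      have h5 := per_mul hper ((i - p) / q) (p + (i - p) % q) (by omega)
      have h6 := Nat.mod_add_div (i - p) q
      rw [mul_comm] at h6
      rw [← h5]
      congr 2
      omega

/-! ### Environments -/

def look (e : List (ℕ × ℕ)) (k : ℕ) : ℕ := (e.lookup k).getD 0
def ep (e : List (ℕ × ℕ)) : ℕ := e.foldr (fun a s => tp a.2 + s) 0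
def eq (e : List (ℕ × ℕ)) : ℕ := e.foldr (fun a s => tq a.2 * s) 1
def en (n : ℕ) (e : List (ℕ × ℕ)) (i k : ℕ) : ℕ := tval n (look e k) i
def We (kc : ℕ) (e : List (ℕ × ℕ)) : ℕ → ℕ → Fin (kn kc + 1) :=
  fun i k => ⟨en (kn kc) e i k, tval_lt _ _ _⟩

lemma look_cons (e : List (ℕ × ℕ)) (k t j : ℕ) :
    look ((k, t) :: e) j = if j = k then t else look e j := by
  unfold look
  rw [List.lookup_cons]
  by_cases h : j = k
  · simp [h]
  · have : (j == k) = false := by simpa using h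
    simp [this, h]

lemma We_cons (kc : ℕ) (e : List (ℕ × ℕ)) (k t : ℕ) :
    We kc ((k, t) :: e) = updW (We kc e) k (fun i => ⟨tval (kn kc) t i, tval_lt _ _ _⟩) := by
  funext i j
  apply Fin.ext
  simp only [We, en, look_cons, updW]
  by_cases h : j = k
  · subst h; simp
  · simp [h, Function.update_of_ne, We, en]

lemma eq_pos (e : List (ℕ × ℕ)) : 0 < eq e := by
  induction e with
  | nil => simp [eq]
  | cons a e ih =>
    have : eq (a :: e) = tq a.2 * eq e := rfl
    rw [this]
    exact Nat.mul_pos (Nat.succ_pos _) ih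

lemma look_bound (e : List (ℕ × ℕ)) (k : ℕ) : tp (look e k) ≤ ep e ∧ tq (look e k) ∣ eq e := by
  induction e with
  | nil => simp [look, tp, tq, ep, eq]
  | cons a e ih =>
    obtain ⟨j, t⟩ := a
    have h1 : ep ((j, t) :: e) = tp t + ep e := rfl
    have h2 : eq ((j, t) :: e) = tq t * eq e := rfl
    rw [look_cons, h1, h2]
    split_ifs
    · exact ⟨by omega, Dvd.intro _ rfl⟩
    · exact ⟨by omega, Dvd.dvd.mul_left ih.2 _⟩

lemma We_per (kc : ℕ) (e : List (ℕ × ℕ)) (i : ℕ) (hi : ep e ≤ i) :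
    We kc e (i + eq e) = We kc e i := by
  funext k
  apply Fin.ext
  simp only [We, en]
  obtain ⟨h1, c, hc⟩ := look_bound e k
  rw [hc, mul_comm]
  exact per_mul (w := fun i => tval (kn kc) (look e k) i)
    (fun i hi => tval_per (kn kc) (look e k) i hi) c i (by omega)

lemma Al_bounded (kc : ℕ) (e : List (ℕ × ℕ)) (Q : ℕ → ℕ → ℕ → Prop) (x y : ℕ) :
    Al (fun i => i < ep e + eq e) Q (fun i => en (kn kc) e i x) (fun i => en (kn kc) e i y) ↔
    Al (fun _ => True) Q (fun i => (We kc e i x).val) (fun i => (We kc e i y).val) := by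
  constructor
  · intro h i _
    induction i using Nat.strong_induction_on with
    | _ i ih =>
      by_cases hi : i < ep e + eq e
      · exact h i hi
      · have hq := eq_pos e
        have h1 := ih (i - eq e) (by omega)
        have h2 := We_per kc e (i - eq e) (by omega)
        have h3 := We_per kc e (i - eq e + 1) (by omega)
        rw [show i - eq e + eq e = i by omega] at h2
        rw [show i - eq e + 1 + eq e = i + 1 by omega] at h3
        simp only [h2, h3]
        exact h1
  · intro h i _
    exact h i trivial

lemma Atom_bounded (kc : ℕ) (e : List (ℕ × ℕ)) (tag a b : ℕ) :
    Atom kc (fun i => i < ep e + eq e) (en (kn kc) e) tag a b ↔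
    Atom kc (fun _ => True) (fun i k => (We kc e i k).val) tag a b := by
  simp only [Atom, Al_bounded]

lemma Dom_bounded (kc : ℕ) (e : List (ℕ × ℕ)) (k so : ℕ) :
    Dom kc (fun i => i < ep e + eq e) (fun i => en (kn kc) e i k) so ↔
    Dom kc (fun _ => True) (fun i => (We kc e i k).val) so := by
  simp only [Dom, Al_bounded]
  rfl

/-! ### The evaluator -/

/-- Bound on the codes of candidate witnesses. -/
def Nt (kc c : ℕ) (e : List (ℕ × ℕ)) : ℕ := ep e + tw kc c * eq e
def Bt (kc c : ℕ) (e : List (ℕ × ℕ)) : ℕ :=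
  ((Nt kc c e + 1) ^ 2 + (kn kc + 1) ^ (2 * Nt kc c e) + 1) ^ 2

/-- A query: code of a structure, code of a formula, environment. -/
abbrev Qry := ℕ × ℕ × List (ℕ × ℕ)

def qtag (b : Qry) : ℕ := b.2.1.unpair.1
def qa (b : Qry) : ℕ := b.2.1.unpair.2.unpair.1
def qb (b : Qry) : ℕ := b.2.1.unpair.2.unpair.2
def qext (b : Qry) (t : ℕ) : List (ℕ × ℕ) := (2 * qa b + (qtag b - 7), t) :: b.2.2
def qdom (t : ℕ) (b : Qry) : Prop :=
  Dom b.1 (fun i => i < ep (qext b t) + eq (qext b t))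
    (fun i => en (kn b.1) (qext b t) i (2 * qa b + (qtag b - 7))) (qtag b - 7)
def qatom (b : Qry) : Prop :=
  Atom b.1 (fun i => i < ep b.2.2 + eq b.2.2) (en (kn b.1) b.2.2) (qtag b) (qa b) (qb b)

open Classical in
noncomputable def children (b : Qry) : List Qry :=
  if qtag b = 5 then [(b.1, b.2.1.unpair.2, b.2.2)]
  else if qtag b = 6 then [(b.1, qa b, b.2.2), (b.1, qb b, b.2.2)]
  else if 7 ≤ qtag b ∧ qtag b ≤ 8 then
    ((List.range (Bt b.1 b.2.1 b.2.2)).filter (fun t => qdom t b)).map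
      (fun t => (b.1, qb b, qext b t))
  else []

def combP (b : Qry) (rs : List Bool) : Prop :=
  (qtag b < 5 ∧ qatom b) ∨ (qtag b = 5 ∧ ¬ ∃ r ∈ rs, r = true) ∨ (5 < qtag b ∧ ∃ r ∈ rs, r = true)

open Classical in
noncomputable def comb (b : Qry) (rs : List Bool) : Bool := decide (combP b rs)

lemma children_lt (b b' : Qry) (h : b' ∈ children b) : b'.2.1 < b.2.1 := by
  have key : b.2.1 = Nat.pair (qtag b) (Nat.pair (qa b) (qb b)) := by simp [qtag, qa, qb]
  have key2 : b.2.1 = Nat.pair (qtag b) b.2.1.unpair.2 := by simp [qtag]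
  unfold children at h
  split_ifs at h with h1 h2 h3
  · simp only [List.mem_singleton] at h
    subst h
    have := enc_lt (qtag b) b.2.1.unpair.2 (by omega)
    rw [← key2] at this
    exact this
  · simp only [List.mem_cons, List.not_mem_nil, or_false] at h
    rw [key]
    rcases h with rfl | rfl
    · exact enc_lt_l _ _ _ (by omega)
    · exact enc_lt_r _ _ _ (by omega)
  · simp only [List.mem_map] at h
    obtain ⟨t, _, rfl⟩ := h
    rw [key]
    exact enc_lt_r _ _ _ (by omega)
  · simp at h

noncomputable def ev (b : Qry) : Bool :=
  comb b ((children b).attach.map fun b' => ev b'.1)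
termination_by b.2.1
decreasing_by exact children_lt b b'.1 b'.2

lemma ev_eq (b : Qry) : ev b = comb b ((children b).map ev) := by
  rw [ev]
  congr 1
  simp

lemma ev_iff (b : Qry) : ev b = true ↔
    (qtag b < 5 ∧ qatom b) ∨ (qtag b = 5 ∧ ¬ ∃ b' ∈ children b, ev b' = true) ∨
      (5 < qtag b ∧ ∃ b' ∈ children b, ev b' = true) := by
  classical
  have hm : (∃ r ∈ (children b).map ev, r = true) ↔ ∃ b' ∈ children b, ev b' = true := by
    constructor
    · rintro ⟨r, hr, h⟩
      obtain ⟨b', hb, rfl⟩ := List.mem_map.1 hr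
      exact ⟨b', hb, h⟩
    · rintro ⟨b', hb, h⟩
      exact ⟨_, List.mem_map.2 ⟨b', hb, rfl⟩, h⟩
  rw [ev_eq, comb, decide_eq_true_iff, combP, hm]

lemma ev_atom (kc tag a b : ℕ) (e : List (ℕ × ℕ)) (ht : tag < 5) :
    ev (kc, Nat.pair tag (Nat.pair a b), e) = true ↔
      Atom kc (fun _ => True) (fun i k => (We kc e i k).val) tag a b := by
  rw [ev_iff, ← Atom_bounded]
  simp only [qtag, qatom, qa, qb, Nat.unpair_pair]
  constructor
  · rintro (h | h | h)
    · exact h.2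
    · omega
    · omega
  · intro h; exact Or.inl ⟨ht, h⟩

lemma ev_ex (kc so x : ℕ) (φ : MPLE) (e : List (ℕ × ℕ)) (hs : so ≤ 1)
    (ih : ∀ e, ev (kc, φ.enc, e) = true ↔ SatW kc (We kc e) φ) :
    ev (kc, Nat.pair (7 + so) (Nat.pair x φ.enc), e) = true ↔
    ∃ y : ℕ → Fin (kn kc + 1), Dom kc (fun _ => True) (fun i => (y i).val) so ∧
      SatW kc (updW (We kc e) (2 * x + so) y) φ := by
  set b : Qry := (kc, Nat.pair (7 + so) (Nat.pair x φ.enc), e) with hb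
  have t1 : qtag b = 7 + so := by simp [qtag, hb]
  have t2 : qa b = x := by simp [qa, hb]
  have t3 : qb b = φ.enc := by simp [qb, hb]
  have t4 : ∀ t, qext b t = (2 * x + so, t) :: e := by
    intro t; rw [qext, t1, t2, Nat.add_sub_cancel_left]
  have t5 : ∀ t, qdom t b ↔ Dom kc (fun _ => True) (fun i => tval (kn kc) t i) so := by
    intro t
    unfold qdom
    rw [show b.1 = kc from rfl, Dom_bounded, t4, t1, t2, Nat.add_sub_cancel_left, We_cons]
    simp only [updW_same]
  rw [ev_iff]
  have hch : (∃ b' ∈ children b, ev b' = true) ↔ ∃ t, t < Bt kc b.2.1 e ∧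
      Dom kc (fun _ => True) (fun i => tval (kn kc) t i) so ∧
      SatW kc (updW (We kc e) (2 * x + so) (fun i => ⟨tval (kn kc) t i, tval_lt _ _ _⟩)) φ := by
    unfold children
    rw [if_neg (by omega), if_neg (by omega), if_pos (by omega)]
    simp only [List.mem_map, List.mem_filter, List.mem_range, decide_eq_true_eq]
    constructor
    · rintro ⟨b', ⟨t, ⟨h1, h2⟩, rfl⟩, h3⟩
      refine ⟨t, h1, (t5 t).1 h2, ?_⟩
      rw [t3, t4, show b.1 = kc from rfl, ih, We_cons] at h3
      exact h3
    · rintro ⟨t, h1, h2, h3⟩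
      refine ⟨_, ⟨t, ⟨h1, (t5 t).2 h2⟩, rfl⟩, ?_⟩
      rw [t3, t4, show b.1 = kc from rfl, ih, We_cons]
      exact h3
  rw [hch, t1]
  constructor
  · rintro (h | h | ⟨_, t, _, h2, h3⟩)
    · omega
    · omega
    · exact ⟨_, h2, h3⟩
  · rintro ⟨y, hy1, hy2⟩
    refine Or.inr (Or.inr ⟨by omega, ?_⟩)
    have hR := (recog_ex kc (2 * x + so) so _ _ (recog_SatW kc φ)).mono
      (show _ ≤ tw kc b.2.1 by
        refine ((sq_lt _).le.trans (tw_succ kc φ.enc).ge).trans (tw_mono kc ?_)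
        exact enc_lt_r _ _ _ (by omega))
    obtain ⟨y', p', q', h1, h2, h3, h4, h5⟩ := bounded_witness hR (2 * x + so) (We kc e)
      (ep e) (eq e) (eq_pos e) (We_per kc e) y (by
        simp only [updW_same]; exact ⟨hy1, hy2⟩)
    simp only [updW_same] at h5
    obtain ⟨t, ht, hty⟩ := exists_code (kn kc) (Nt kc b.2.1 e) y' p' q' h1 h2
      (by unfold Nt; omega) h4
    have hy' : (fun i => (⟨tval (kn kc) t i, tval_lt _ _ _⟩ : Fin (kn kc + 1))) = y' := by
      funext i; exact Fin.ext (hty i)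
    refine ⟨t, ht, ?_, ?_⟩
    · simp only [hty]; exact h5.1
    · rw [hy']; exact h5.2

theorem ev_correct (kc : ℕ) (φ : MPLE) : ∀ e : List (ℕ × ℕ),
    ev (kc, φ.enc, e) = true ↔ SatW kc (We kc e) φ := by
  induction φ with
  | patom a x => intro e; exact ev_atom kc 0 a x e (by norm_num)
  | lt x y => intro e; exact ev_atom kc 1 x y e (by norm_num)
  | eq x y => intro e; exact ev_atom kc 2 x y e (by norm_num)
  | mem x y => intro e; exact ev_atom kc 3 x y e (by norm_num)
  | eqlevel x y => intro e; exact ev_atom kc 4 x y e (by norm_num)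
  | not φ ih =>
    intro e
    rw [ev_iff]
    simp [qtag, MPLE.enc, children, SatW, ← ih]
  | or φ₁ φ₂ ih1 ih2 =>
    intro e
    rw [ev_iff]
    simp [qtag, qa, qb, MPLE.enc, children, SatW, ← ih1, ← ih2]
  | exFO x φ ih => intro e; exact ev_ex kc 0 x φ e (by norm_num) ih
  | exSO x φ ih => intro e; exact ev_ex kc 1 x φ e (by norm_num) ih

/-! ### Primitive recursiveness of the evaluator -/

section Prim
variable {α : Type} [Primcodable α]

lemma pall {B : α → ℕ} {P : α → ℕ → Prop} (hB : Primrec B)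
    (hP : PrimrecPred fun q : ℕ × α => P q.2 q.1) : PrimrecPred fun a => ∀ i, i < B a → P a i := by
  have h : PrimrecRel fun (i : ℕ) (a : α) => P a i := hP
  exact (h.forall_mem_list.comp (Primrec.list_range.comp hB) Primrec.id).of_eq (by simp)

lemma pex_list {β : Type} [Primcodable β] {B : α → List β} {P : α → β → Prop} (hB : Primrec B)
    (hP : PrimrecPred fun q : β × α => P q.2 q.1) : PrimrecPred fun a => ∃ i ∈ B a, P a i := by
  have h : PrimrecRel fun (i : β) (a : α) => P a i := hP
  exact (h.exists_mem_list.comp hB Primrec.id).of_eq (by simp)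

lemma padd {f g : α → ℕ} (hf : Primrec f) (hg : Primrec g) : Primrec fun a => f a + g a :=
  Primrec.nat_add.comp hf hg
lemma psub {f g : α → ℕ} (hf : Primrec f) (hg : Primrec g) : Primrec fun a => f a - g a :=
  Primrec.nat_sub.comp hf hg
lemma pmul {f g : α → ℕ} (hf : Primrec f) (hg : Primrec g) : Primrec fun a => f a * g a :=
  Primrec.nat_mul.comp hf hg
lemma pdiv {f g : α → ℕ} (hf : Primrec f) (hg : Primrec g) : Primrec fun a => f a / g a :=
  Primrec.nat_div.comp hf hg
lemma pmod {f g : α → ℕ} (hf : Primrec f) (hg : Primrec g) : Primrec fun a => f a % g a :=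
  Primrec.nat_mod.comp hf hg
lemma ppow {f g : α → ℕ} (hf : Primrec f) (hg : Primrec g) : Primrec fun a => f a ^ g a :=
  (Primrec₂.unpaired'.1 Nat.Primrec.pow).comp hf hg
lemma pu1 {f : α → ℕ} (hf : Primrec f) : Primrec fun a => (f a).unpair.1 :=
  Primrec.fst.comp (Primrec.unpair.comp hf)
lemma pu2 {f : α → ℕ} (hf : Primrec f) : Primrec fun a => (f a).unpair.2 :=
  Primrec.snd.comp (Primrec.unpair.comp hf)
lemma peq {β : Type} [Primcodable β] {f g : α → β} (hf : Primrec f) (hg : Primrec g) :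
    PrimrecPred fun a => f a = g a :=
  Primrec.eq.comp hf hg
lemma plt {f g : α → ℕ} (hf : Primrec f) (hg : Primrec g) : PrimrecPred fun a => f a < g a :=
  Primrec.nat_lt.comp hf hg
lemma ple {f g : α → ℕ} (hf : Primrec f) (hg : Primrec g) : PrimrecPred fun a => f a ≤ g a :=
  Primrec.nat_le.comp hf hg

lemma pkn {f : α → ℕ} (hf : Primrec f) : Primrec fun a => kn (f a) := pu1 hf
lemma pkinit {f : α → ℕ} (hf : Primrec f) : Primrec fun a => kinit (f a) := pu1 (pu2 hf)
lemma pklist {f : α → ℕ} (hf : Primrec f) : Primrec fun a => klist (f a) :=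
  Primrec.option_getD.comp (Primrec.decode.comp hf) (Primrec.const [])
lemma pktrans {f : α → ℕ} (hf : Primrec f) : Primrec fun a => ktrans (f a) :=
  pklist (pu1 (pu2 (pu2 hf)))
lemma pklabel {f : α → ℕ} (hf : Primrec f) : Primrec fun a => klabel (f a) :=
  pklist (pu2 (pu2 (pu2 hf)))

lemma pTR {f g h : α → ℕ} (hf : Primrec f) (hg : Primrec g) (hh : Primrec h) :
    PrimrecPred fun a => TR (f a) (g a) (h a) := by
  unfold TR
  refine (peq hg (Primrec.const 0)).not.and ((peq hh (Primrec.const 0)).not.and (pex_list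
    ((Primrec.list_getD []).comp (pktrans hf) (psub hg (Primrec.const 1))) ?_))
  exact peq Primrec.fst (psub (hh.comp Primrec.snd) (Primrec.const 1))

lemma pLB {f g h : α → ℕ} (hf : Primrec f) (hg : Primrec g) (hh : Primrec h) :
    PrimrecPred fun a => LB (f a) (g a) (h a) := by
  unfold LB
  refine (peq hh (Primrec.const 0)).not.and (pex_list
    ((Primrec.list_getD []).comp (pklabel hf) (psub hh (Primrec.const 1))) ?_)
  exact peq Primrec.fst (hg.comp Primrec.snd)

lemma ptp {f : α → ℕ} (hf : Primrec f) : Primrec fun a => tp (f a) := pu1 (pu1 hf)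
lemma ptq {f : α → ℕ} (hf : Primrec f) : Primrec fun a => tq (f a) :=
  padd (pu2 (pu1 hf)) (Primrec.const 1)

lemma ptval {f g h : α → ℕ} (hf : Primrec f) (hg : Primrec g) (hh : Primrec h) :
    Primrec fun a => tval (f a) (g a) (h a) := by
  unfold tval
  have hn := padd hf (Primrec.const 1)
  refine pmod (pdiv (pu2 hg) (ppow hn (Primrec.ite (plt hh (ptp hg)) hh ?_))) hn
  exact padd (ptp hg) (pmod (psub hh (ptp hg)) (ptq hg))

lemma plook {f : α → List (ℕ × ℕ)} {g : α → ℕ} (hf : Primrec f) (hg : Primrec g) :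
    Primrec fun a => look (f a) (g a) :=
  Primrec.option_getD.comp (Primrec.listLookup.comp hg hf) (Primrec.const 0)

lemma pep {f : α → List (ℕ × ℕ)} (hf : Primrec f) : Primrec fun a => ep (f a) := by
  have h2 : Primrec fun q : α × ((ℕ × ℕ) × ℕ) => tp q.2.1.2 :=
    ptp (Primrec.snd.comp (Primrec.fst.comp Primrec.snd))
  have h3 : Primrec fun q : α × ((ℕ × ℕ) × ℕ) => q.2.2 := Primrec.snd.comp Primrec.snd
  have h1 : Primrec fun q : α × ((ℕ × ℕ) × ℕ) => tp q.2.1.2 + q.2.2 := padd h2 h3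
  have h4 : Primrec₂ fun (_ : α) (p : (ℕ × ℕ) × ℕ) => tp p.1.2 + p.2 := h1
  exact Primrec.list_foldr hf (Primrec.const 0) h4

lemma peqq {f : α → List (ℕ × ℕ)} (hf : Primrec f) : Primrec fun a => eq (f a) := by
  have h2 : Primrec fun q : α × ((ℕ × ℕ) × ℕ) => tq q.2.1.2 :=
    ptq (Primrec.snd.comp (Primrec.fst.comp Primrec.snd))
  have h3 : Primrec fun q : α × ((ℕ × ℕ) × ℕ) => q.2.2 := Primrec.snd.comp Primrec.snd
  have h1 : Primrec fun q : α × ((ℕ × ℕ) × ℕ) => tq q.2.1.2 * q.2.2 := pmul h2 h3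
  have h4 : Primrec₂ fun (_ : α) (p : (ℕ × ℕ) × ℕ) => tq p.1.2 * p.2 := h1
  exact Primrec.list_foldr hf (Primrec.const 1) h4

lemma pen {n : α → ℕ} {f : α → List (ℕ × ℕ)} {i k : α → ℕ} (hn : Primrec n) (hf : Primrec f)
    (hi : Primrec i) (hk : Primrec k) : Primrec fun a => en (n a) (f a) (i a) (k a) :=
  ptval hn (plook hf hk) hi

lemma pAl {n : α → ℕ} {f : α → List (ℕ × ℕ)} {H x y : α → ℕ} {Q : α → ℕ → ℕ → ℕ → Prop}
    (hn : Primrec n) (hf : Primrec f) (hH : Primrec H) (hx : Primrec x) (hy : Primrec y)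
    (hQ : PrimrecPred fun q : α × ℕ × ℕ × ℕ => Q q.1 q.2.1 q.2.2.1 q.2.2.2) :
    PrimrecPred fun a => Al (fun i => i < H a) (Q a) (fun i => en (n a) (f a) i (x a))
      (fun i => en (n a) (f a) i (y a)) := by
  unfold Al
  refine pall hH ?_
  have s := Primrec.snd (α := ℕ) (β := α)
  have t := Primrec.fst (α := ℕ) (β := α)
  exact hQ.comp (Primrec.pair s (Primrec.pair (pen (hn.comp s) (hf.comp s) t (hx.comp s))
    (Primrec.pair (pen (hn.comp s) (hf.comp s) t (hy.comp s))
      (pen (hn.comp s) (hf.comp s) (padd t (Primrec.const 1)) (hx.comp s)))))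

lemma pqs1 : Primrec fun q : α × ℕ × ℕ × ℕ => q.2.1 := Primrec.fst.comp Primrec.snd
lemma pqs2 : Primrec fun q : α × ℕ × ℕ × ℕ => q.2.2.1 :=
  Primrec.fst.comp (Primrec.snd.comp Primrec.snd)
lemma pqs3 : Primrec fun q : α × ℕ × ℕ × ℕ => q.2.2.2 :=
  Primrec.snd.comp (Primrec.snd.comp Primrec.snd)

lemma pAtom {kc tag x y : α → ℕ} {f : α → List (ℕ × ℕ)} (hkc : Primrec kc)
    (ht : Primrec tag) (hx : Primrec x) (hy : Primrec y) (hf : Primrec f) :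
    PrimrecPred fun a => Atom (kc a) (fun i => i < ep (f a) + eq (f a)) (en (kn (kc a)) (f a))
      (tag a) (x a) (y a) := by
  unfold Atom
  have hH := padd (pep hf) (peqq hf)
  have hn := pkn hkc
  have hx2 := pmul (Primrec.const 2) hx
  have hy2 := pmul (Primrec.const 2) hy
  have hy3 := padd hy2 (Primrec.const 1)
  have z : Primrec fun _ : α × ℕ × ℕ × ℕ => 0 := Primrec.const 0
  have qs : PrimrecPred fun q : α × ℕ × ℕ × ℕ => qSub q.2.1 q.2.2.1 q.2.2.2 :=
    (peq pqs1 z).or (peq pqs1 pqs2)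
  have qe : PrimrecPred fun q : α × ℕ × ℕ × ℕ => qEq q.2.1 q.2.2.1 q.2.2.2 :=
    peq pqs1 pqs2
  have ql : PrimrecPred fun q : α × ℕ × ℕ × ℕ => qLev q.2.1 q.2.2.1 q.2.2.2 :=
    ((peq pqs1 z).and (peq pqs2 z)).or ((peq pqs1 z).not.and (peq pqs2 z).not)
  have qp : PrimrecPred fun q : α × ℕ × ℕ × ℕ =>
      qPat (kc q.1) (x q.1) q.2.1 q.2.2.1 q.2.2.2 :=
    ((pLB (hkc.comp Primrec.fst) (hx.comp Primrec.fst) pqs1).and (peq pqs3 z)).not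
  have c : ∀ m : ℕ, PrimrecPred fun a => tag a = m := fun m => peq ht (Primrec.const m)
  exact ((c 0).and (pAl hn hf hH hy2 hy2 (Q := fun a => qPat (kc a) (x a)) qp).not).or
    (((c 1).and ((pAl hn hf hH hx2 hy2 (Q := fun _ => qSub) qs).and
      (pAl hn hf hH hx2 hy2 (Q := fun _ => qEq) qe).not)).or
    (((c 2).and (pAl hn hf hH hx2 hy2 (Q := fun _ => qEq) qe)).or
    (((c 3).and (pAl hn hf hH hx2 hy3 (Q := fun _ => qSub) qs)).or
    ((c 4).and (pAl hn hf hH hx2 hy2 (Q := fun _ => qLev) ql)))))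

lemma pDom {kc so x : α → ℕ} {f : α → List (ℕ × ℕ)} (hkc : Primrec kc)
    (hs : Primrec so) (hx : Primrec x) (hf : Primrec f) :
    PrimrecPred fun a => Dom (kc a) (fun i => i < ep (f a) + eq (f a))
      (fun i => en (kn (kc a)) (f a) i (x a)) (so a) := by
  unfold Dom
  have hH := padd (pep hf) (peqq hf)
  have hn := pkn hkc
  have z : Primrec fun _ : α × ℕ × ℕ × ℕ => 0 := Primrec.const 0
  have z' : Primrec fun _ : α => 0 := Primrec.const 0
  have qf : PrimrecPred fun q : α × ℕ × ℕ × ℕ => qFin q.2.1 q.2.2.1 q.2.2.2 :=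
    (peq pqs1 z).not
  have qp : PrimrecPred fun q : α × ℕ × ℕ × ℕ => qPath (kc q.1) q.2.1 q.2.2.1 q.2.2.2 :=
    (peq pqs3 z).or (pTR (hkc.comp Primrec.fst) pqs1 pqs3)
  have h0 := pen hn hf z' hx
  have hA := pAl hn hf hH hx hx (Q := fun _ => qFin) qf
  exact ((peq h0 z').or (peq h0 (padd (pkinit hkc) (Primrec.const 1)))).and
    ((pAl hn hf hH hx hx (Q := fun a => qPath (kc a)) qp).and
      (((peq hs z').and hA.not).or ((peq hs z').not.and hA)))

lemma plsz {kc : α → ℕ} (hkc : Primrec kc) : Primrec fun a => lsz (kc a) := by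
  unfold lsz
  have h1 := padd (pkn hkc) (Primrec.const 1)
  have h2 := padd (pmul h1 h1) (Primrec.const 1)
  exact pmul h2 (pmul h2 (Primrec.const 2))

lemma ptw {kc k : α → ℕ} (hkc : Primrec kc) (hk : Primrec k) :
    Primrec fun a => tw (kc a) (k a) := by
  unfold tw
  refine Primrec.nat_iterate (h := fun _ m => 2 ^ (m * m)) hk (pmul (plsz hkc) (plsz hkc)) ?_
  exact Primrec.to₂ (ppow (Primrec.const 2) (pmul Primrec.snd Primrec.snd))

lemma pBt {kc c : α → ℕ} {f : α → List (ℕ × ℕ)} (hkc : Primrec kc) (hc : Primrec c)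
    (hf : Primrec f) : Primrec fun a => Bt (kc a) (c a) (f a) := by
  unfold Bt
  have hN : Primrec fun a => Nt (kc a) (c a) (f a) :=
    padd (pep hf) (pmul (ptw hkc hc) (peqq hf))
  exact ppow (padd (padd (ppow (padd hN (Primrec.const 1)) (Primrec.const 2))
    (ppow (padd (pkn hkc) (Primrec.const 1)) (pmul (Primrec.const 2) hN))) (Primrec.const 1))
    (Primrec.const 2)

lemma pqc {b : α → Qry} (hb : Primrec b) : Primrec fun a => (b a).2.1 :=
  Primrec.fst.comp (Primrec.snd.comp hb)
lemma pqe {b : α → Qry} (hb : Primrec b) : Primrec fun a => (b a).2.2 :=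
  Primrec.snd.comp (Primrec.snd.comp hb)
lemma pqk {b : α → Qry} (hb : Primrec b) : Primrec fun a => (b a).1 := Primrec.fst.comp hb
lemma pqtag {b : α → Qry} (hb : Primrec b) : Primrec fun a => qtag (b a) := pu1 (pqc hb)
lemma pqa {b : α → Qry} (hb : Primrec b) : Primrec fun a => qa (b a) := pu1 (pu2 (pqc hb))
lemma pqb {b : α → Qry} (hb : Primrec b) : Primrec fun a => qb (b a) := pu2 (pu2 (pqc hb))
lemma pqvar {b : α → Qry} (hb : Primrec b) :
    Primrec fun a => 2 * qa (b a) + (qtag (b a) - 7) :=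
  padd (pmul (Primrec.const 2) (pqa hb)) (psub (pqtag hb) (Primrec.const 7))
lemma pqext {b : α → Qry} {t : α → ℕ} (hb : Primrec b) (ht : Primrec t) :
    Primrec fun a => qext (b a) (t a) :=
  Primrec.list_cons.comp (Primrec.pair (pqvar hb) ht) (pqe hb)

end Prim

lemma prim_qdom : PrimrecRel qdom := by
  have t := Primrec.fst (α := ℕ) (β := Qry)
  have b := Primrec.snd (α := ℕ) (β := Qry)
  exact pDom (pqk b) (psub (pqtag b) (Primrec.const 7)) (pqvar b) (pqext b t)

lemma prim_qatom : PrimrecPred qatom := by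
  have b := Primrec.id (α := Qry)
  exact pAtom (pqk b) (pqtag b) (pqa b) (pqb b) (pqe b)

lemma prim_children : Primrec children := by
  classical
  have b := Primrec.id (α := Qry)
  have b1 := Primrec.fst (α := Qry) (β := ℕ)
  have t1 := Primrec.snd (α := Qry) (β := ℕ)
  have c : ∀ m : ℕ, PrimrecPred fun b : Qry => qtag b = m :=
    fun m => peq (pqtag b) (Primrec.const m)
  have nil : Primrec fun _ : Qry => ([] : List Qry) := Primrec.const []
  have hfil : Primrec fun b : Qry =>
      (List.range (Bt b.1 b.2.1 b.2.2)).filter (fun t => qdom t b) :=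
    (prim_qdom.listFilter).comp (Primrec.list_range.comp (pBt (pqk b) (pqc b) (pqe b))) b
  unfold children
  refine Primrec.ite (c 5) ?_ (Primrec.ite (c 6) ?_ (Primrec.ite ?_ ?_ nil))
  · exact Primrec.list_cons.comp (Primrec.pair (pqk b) (Primrec.pair (pu2 (pqc b)) (pqe b))) nil
  · exact Primrec.list_cons.comp (Primrec.pair (pqk b) (Primrec.pair (pqa b) (pqe b)))
      (Primrec.list_cons.comp (Primrec.pair (pqk b) (Primrec.pair (pqb b) (pqe b))) nil)
  · exact (ple (Primrec.const 7) (pqtag b)).and (ple (pqtag b) (Primrec.const 8))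
  · refine Primrec.list_map (g := fun b t => (b.1, qb b, qext b t)) hfil ?_
    exact Primrec.to₂ (Primrec.pair (pqk b1) (Primrec.pair (pqb b1) (pqext b1 t1)))

lemma prim_comb : Primrec₂ comb := by
  classical
  have b := Primrec.fst (α := Qry) (β := List Bool)
  have r := Primrec.snd (α := Qry) (β := List Bool)
  have hex : PrimrecPred fun q : Qry × List Bool => ∃ r ∈ q.2, r = true :=
    pex_list r (peq Primrec.fst (Primrec.const true))
  have : PrimrecPred fun q : Qry × List Bool => combP q.1 q.2 :=
    ((plt (pqtag b) (Primrec.const 5)).and (prim_qatom.comp b)).or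
    (((peq (pqtag b) (Primrec.const 5)).and hex.not).or
    ((plt (Primrec.const 5) (pqtag b)).and hex))
  have h := primrecPred_iff_primrec_decide.1 this
  refine h.of_eq ?_
  intro q
  simp [comb]

theorem prim_ev : Primrec ev := by
  refine Primrec.nat_omega_rec' ev (m := fun b => b.2.1) (l := children)
    (g := fun b rs => some (comb b rs)) (pqc Primrec.id) prim_children
    (Primrec.option_some.comp₂ prim_comb) children_lt ?_
  intro b
  rw [← ev_eq]


/-! ### Connection with Kripke structures -/

lemma kn_enc (K : FinKripke) : kn K.enc = K.n := by simp [kn, FinKripke.enc]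
lemma kinit_enc (K : FinKripke) : kinit K.enc = K.init.val := by simp [kinit, FinKripke.enc]

lemma TR_enc (K : FinKripke) (s s' : Fin K.n) :
    TR K.enc (s.val + 1) (s'.val + 1) ↔ s' ∈ K.trans s := by
  have : (ktrans K.enc).getD s.val [] = ((K.trans s).sort (· ≤ ·)).map Fin.val := by
    simp [ktrans, klist, FinKripke.enc, List.getD_eq_getElem?_getD]
  simp only [TR, Nat.add_sub_cancel, this]
  simp only [ne_eq, Nat.add_eq_zero_iff, one_ne_zero, and_false, not_false_eq_true, true_and,
    List.mem_map, Finset.mem_sort]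
  constructor
  · rintro ⟨z, ⟨t, ht, rfl⟩, h⟩
    rwa [← Fin.ext h]
  · intro h
    exact ⟨_, ⟨s', h, rfl⟩, rfl⟩

lemma LB_enc (K : FinKripke) (a : ℕ) (s : Fin K.n) :
    LB K.enc a (s.val + 1) ↔ a ∈ K.label s := by
  have : (klabel K.enc).getD s.val [] = (K.label s).sort (· ≤ ·) := by
    simp [klabel, klist, FinKripke.enc, List.getD_eq_getElem?_getD]
  simp only [LB, Nat.add_sub_cancel, this]
  simp

/-- The track of a finite sequence of states. -/
def encL {n : ℕ} (l : List (Fin n)) (i : ℕ) : ℕ := (l[i]?).elim 0 (fun s => s.val + 1)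

section EncL
variable {n : ℕ}

lemma encL_lt (l : List (Fin n)) (i : ℕ) (h : i < l.length) : encL l i = l[i].val + 1 := by
  simp [encL, h]

lemma encL_ge (l : List (Fin n)) (i : ℕ) (h : l.length ≤ i) : encL l i = 0 := by
  simp [encL, h]

lemma encL_zero (l : List (Fin n)) (i : ℕ) : encL l i = 0 ↔ l.length ≤ i := by
  constructor
  · intro h
    by_contra h'
    rw [encL_lt l i (by omega)] at h
    omega
  · exact encL_ge l i

lemma encL_bd (l : List (Fin n)) (i : ℕ) : encL l i < n + 1 := by
  by_cases h : i < l.length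
  · rw [encL_lt l i h]; have := l[i].isLt; omega
  · rw [encL_ge l i (by omega)]; omega

lemma encL_eq (l l' : List (Fin n)) (i : ℕ) : encL l i = encL l' i ↔ l[i]? = l'[i]? := by
  unfold encL
  cases l[i]? <;> cases l'[i]? <;> simp [Fin.ext_iff]

lemma encL_all_eq (l l' : List (Fin n)) : (∀ i, encL l i = encL l' i) ↔ l = l' := by
  simp only [encL_eq]
  exact ⟨List.ext_getElem?, fun h => by simp [h]⟩

lemma encL_sub (l l' : List (Fin n)) :
    (∀ i, encL l i = 0 ∨ encL l i = encL l' i) ↔ l <+: l' := by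
  rw [List.prefix_iff_getElem?]
  constructor
  · intro h i hi
    rcases h i with h | h
    · rw [encL_zero] at h; omega
    · rw [encL_eq] at h
      rw [← h]; simp [hi]
  · intro h i
    by_cases hi : i < l.length
    · right
      rw [encL_eq, h i hi]; simp [hi]
    · left; exact encL_ge _ _ (by omega)

lemma encL_map (m : ℕ) (p : ℕ → Fin n) (i : ℕ) :
    encL ((List.range m).map p) i = if i < m then (p i).val + 1 else 0 := by
  split_ifs with h
  · rw [encL_lt _ _ (by simpa using h)]; simp
  · exact encL_ge _ _ (by simpa using h)

lemma encL_mem (l : List (Fin n)) (p : ℕ → Fin n) :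
    (∀ i, encL l i = 0 ∨ encL l i = (p i).val + 1) ↔ l = (List.range l.length).map p := by
  rw [← encL_all_eq]
  refine forall_congr' fun i => ?_
  rw [encL_map]
  split_ifs with h
  · have : encL l i ≠ 0 := by rw [Ne, encL_zero]; omega
    simp [this]
  · simp [encL_ge l i (by omega)]

lemma encL_lev (l l' : List (Fin n)) :
    (∀ i, (encL l i = 0 ∧ encL l' i = 0) ∨ (¬ encL l i = 0 ∧ ¬ encL l' i = 0)) ↔
      l.length = l'.length := by
  simp only [encL_zero]
  constructor
  · intro h
    have h1 := h l.length
    have h2 := h l'.length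
    omega
  · intro h i
    omega

end EncL

lemma encL_pat (K : FinKripke) (a : ℕ) (l : List (Fin K.n)) :
    (∃ i, LB K.enc a (encL l i) ∧ encL l (i + 1) = 0) ↔ a ∈ K.seqLabel l := by
  constructor
  · rintro ⟨i, h1, h2⟩
    have h0 : encL l i ≠ 0 := h1.1
    rw [Ne, encL_zero] at h0
    rw [encL_zero] at h2
    have hi : i < l.length := by omega
    rw [encL_lt l i hi, LB_enc] at h1
    have hl : l.getLast? = some l[i] := by
      rw [List.getLast?_eq_getElem?, show l.length - 1 = i by omega]
      simp [hi]
    simp only [FinKripke.seqLabel, hl]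
    exact h1
  · intro h
    unfold FinKripke.seqLabel at h
    split at h
    · rename_i s hs
      rw [List.getLast?_eq_getElem?] at hs
      obtain ⟨hi, hs⟩ := List.getElem?_eq_some_iff.1 hs
      refine ⟨l.length - 1, ?_, encL_ge _ _ (by omega)⟩
      rw [encL_lt l _ hi, LB_enc, hs]
      exact h
    · exact absurd h (Set.notMem_empty a)

lemma exists_path (K : FinKripke) (x : ℕ → ℕ) (hb : ∀ i, x i < K.n + 1)
    (h0 : x 0 = 0 ∨ x 0 = kinit K.enc + 1) (hs : ∀ i, x (i + 1) = 0 ∨ TR K.enc (x i) (x (i + 1))) :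
    ∃ p : ℕ → Fin K.n, K.IsPath p ∧ ∀ i, x i ≠ 0 → x i = (p i).val + 1 := by
  choose g hg using K.trans_nonempty
  let p : ℕ → Fin K.n := fun i => Nat.rec K.init
    (fun j s => if h : x (j + 1) ≠ 0 then ⟨x (j + 1) - 1, by have := hb (j + 1); omega⟩ else g s) i
  have hp0 : p 0 = K.init := rfl
  have hps : ∀ j, p (j + 1) = if h : x (j + 1) ≠ 0 then
    ⟨x (j + 1) - 1, by have := hb (j + 1); omega⟩ else g (p j) := fun j => rfl
  have hx : ∀ i, x i ≠ 0 → x i = (p i).val + 1 := by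
    intro i hi
    cases i with
    | zero =>
      rw [hp0, ← kinit_enc]
      exact h0.resolve_left hi
    | succ j =>
      rw [hps, dif_pos hi]
      simp only
      omega
  refine ⟨p, ⟨hp0, fun i => ?_⟩, hx⟩
  by_cases h : x (i + 1) = 0
  · rw [hps, dif_neg (by simpa using h)]
    exact hg _
  · have ht := (hs i).resolve_left h
    have h1 := hx i ht.1
    have h2 := hx (i + 1) h
    rw [h1, h2, TR_enc] at ht
    exact ht

lemma Dom_FO (K : FinKripke) (x : ℕ → ℕ) (hb : ∀ i, x i < K.n + 1) :
    Dom K.enc (fun _ => True) x 0 ↔ ∃ l, K.IsPathPrefix l ∧ ∀ i, x i = encL l i := by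
  simp only [Dom, Al, qPath, qFin, forall_const, true_and, not_true_eq_false, false_and, or_false,
    not_forall, not_not]
  constructor
  · rintro ⟨h0, hs, hz⟩
    obtain ⟨p, hp, hx⟩ := exists_path K x hb h0 hs
    classical
    have hge : ∀ k, x (Nat.find hz + k) = 0 := by
      intro k
      induction k with
      | zero => exact Nat.find_spec hz
      | succ k ih =>
        rcases hs (Nat.find hz + k) with h | h
        · exact h
        · exact absurd ih h.1
    refine ⟨(List.range (Nat.find hz)).map p, ⟨p, hp, by simp⟩, fun i => ?_⟩
    rw [encL_map]
    split_ifs with h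
    · exact hx i (Nat.find_min hz h)
    · have := hge (i - Nat.find hz)
      rwa [Nat.add_sub_cancel' (by omega)] at this
  · rintro ⟨l, ⟨p, hp, hl⟩, hx⟩
    have hx' := hx
    rw [hl] at hx'
    simp only [encL_map] at hx'
    refine ⟨?_, ?_, l.length, ?_⟩
    · rw [hx', kinit_enc, hp.1]
      split_ifs <;> simp
    · intro i
      by_cases h : i + 1 < l.length
      · right
        rw [hx', hx', if_pos h, if_pos (by omega), TR_enc]
        exact hp.2 i
      · left
        rw [hx', if_neg h]
    · rw [hx, encL_ge _ _ le_rfl]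

lemma Dom_SO (K : FinKripke) (x : ℕ → ℕ) (hb : ∀ i, x i < K.n + 1) :
    Dom K.enc (fun _ => True) x 1 ↔ ∃ p, K.IsPath p ∧ ∀ i, x i = (p i).val + 1 := by
  simp only [Dom, Al, qPath, qFin, forall_const, one_ne_zero, false_and, false_or,
    not_false_eq_true, true_and]
  constructor
  · rintro ⟨h0, hs, hz⟩
    obtain ⟨p, hp, hx⟩ := exists_path K x hb h0 hs
    exact ⟨p, hp, fun i => hx i (hz i)⟩
  · rintro ⟨p, hp, hx⟩
    refine ⟨?_, ?_, ?_⟩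
    · rw [hx, kinit_enc, hp.1]; simp
    · intro i
      right
      rw [hx, hx, TR_enc]
      exact hp.2 i
    · intro i; rw [hx]; omega

lemma updW_ne {B : Type} (w : ℕ → ℕ → B) (k j : ℕ) (y : ℕ → B) (i : ℕ) (h : j ≠ k) :
    updW w k y i j = w i j := by simp [updW, h]

theorem SatW_iff (K : FinKripke) (φ : MPLE) :
    ∀ (w : ℕ → ℕ → Fin (kn K.enc + 1)) (V₁ : ℕ → List (Fin K.n)) (V₂ : ℕ → Set (List (Fin K.n))),
    (∀ x ∈ φ.freeFO, ∀ i, (w i (2 * x)).val = encL (V₁ x) i) →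
    (∀ X ∈ φ.freeSO, ∃ p, V₂ X = K.PrefixSet p ∧ ∀ i, (w i (2 * X + 1)).val = (p i).val + 1) →
    (SatW K.enc w φ ↔ MPLE.Sat K V₁ V₂ φ) := by
  have hbd : ∀ (y : ℕ → Fin (kn K.enc + 1)) i, (y i).val < K.n + 1 := by
    intro y i
    have := (y i).isLt
    exact this.trans_eq (by rw [kn_enc])
  induction φ with
  | patom a x =>
    intro w V₁ V₂ h1 h2
    have hx := h1 x (by simp [MPLE.freeFO])
    simp only [SatW, Atom, Al, MPLE.Sat, hx, ← encL_pat, qPat]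
    simp
  | lt x y =>
    intro w V₁ V₂ h1 h2
    have hx := h1 x (by simp [MPLE.freeFO])
    have hy := h1 y (by simp [MPLE.freeFO])
    simp only [SatW, Atom, Al, MPLE.Sat, hx, hy, qSub, qEq, forall_const, encL_sub, encL_all_eq]
    simp
  | eq x y =>
    intro w V₁ V₂ h1 h2
    have hx := h1 x (by simp [MPLE.freeFO])
    have hy := h1 y (by simp [MPLE.freeFO])
    simp only [SatW, Atom, Al, MPLE.Sat, hx, hy, qSub, qEq, forall_const, encL_sub, encL_all_eq]
    simp
  | mem x X =>
    intro w V₁ V₂ h1 h2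
    have hx := h1 x (by simp [MPLE.freeFO])
    obtain ⟨p, hp, hX⟩ := h2 X (by simp [MPLE.freeSO])
    simp only [SatW, Atom, Al, MPLE.Sat, hx, hX, qSub, forall_const, encL_mem, hp,
      FinKripke.PrefixSet, Set.mem_setOf_eq]
    simp
  | eqlevel x y =>
    intro w V₁ V₂ h1 h2
    have hx := h1 x (by simp [MPLE.freeFO])
    have hy := h1 y (by simp [MPLE.freeFO])
    simp only [SatW, Atom, Al, MPLE.Sat, hx, hy, qLev, forall_const, encL_lev]
    simp
  | not φ ih =>
    intro w V₁ V₂ h1 h2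
    simp only [SatW, MPLE.Sat]
    rw [ih w V₁ V₂ h1 h2]
  | or φ₁ φ₂ ih1 ih2 =>
    intro w V₁ V₂ h1 h2
    simp only [SatW, MPLE.Sat]
    rw [ih1 w V₁ V₂ (fun x hx => h1 x (Finset.mem_union_left _ hx))
      (fun x hx => h2 x (Finset.mem_union_left _ hx)),
      ih2 w V₁ V₂ (fun x hx => h1 x (Finset.mem_union_right _ hx))
      (fun x hx => h2 x (Finset.mem_union_right _ hx))]
  | exFO x φ ih =>
    intro w V₁ V₂ h1 h2
    have key : ∀ (y : ℕ → Fin (kn K.enc + 1)) (l : List (Fin K.n)),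
        (∀ i, (y i).val = encL l i) →
        (SatW K.enc (updW w (2 * x + 0) y) φ ↔ MPLE.Sat K (Function.update V₁ x l) V₂ φ) := by
      intro y l hyl
      apply ih
      · intro z hz i
        by_cases hzx : z = x
        · subst hzx
          rw [Function.update_self, ← hyl i]
          exact congrArg Fin.val (updW_same w (2 * z) y i)
        · rw [Function.update_of_ne hzx, updW_ne _ _ _ _ _ (by omega)]
          exact h1 z (by simp [MPLE.freeFO, hz, hzx]) i
      · intro X hX
        obtain ⟨p, hp, hw⟩ := h2 X hX
        refine ⟨p, hp, fun i => ?_⟩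
        rw [updW_ne _ _ _ _ _ (by omega)]
        exact hw i
    simp only [SatW, MPLE.Sat]
    constructor
    · rintro ⟨y, hd, hy⟩
      obtain ⟨l, hl, hyl⟩ := (Dom_FO K _ (hbd y)).1 hd
      exact ⟨l, hl, (key y l hyl).1 hy⟩
    · rintro ⟨l, hl, hs⟩
      let y : ℕ → Fin (kn K.enc + 1) := fun i => ⟨encL l i, by rw [kn_enc]; exact encL_bd l i⟩
      have hyl : ∀ i, (y i).val = encL l i := fun i => rfl
      exact ⟨y, (Dom_FO K _ (hbd y)).2 ⟨l, hl, hyl⟩, (key y l hyl).2 hs⟩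
  | exSO X φ ih =>
    intro w V₁ V₂ h1 h2
    have key : ∀ (y : ℕ → Fin (kn K.enc + 1)) (p : ℕ → Fin K.n),
        (∀ i, (y i).val = (p i).val + 1) →
        (SatW K.enc (updW w (2 * X + 1) y) φ ↔
          MPLE.Sat K V₁ (Function.update V₂ X (K.PrefixSet p)) φ) := by
      intro y p hyp
      apply ih
      · intro z hz i
        rw [updW_ne _ _ _ _ _ (by omega)]
        exact h1 z hz i
      · intro Z hZ
        by_cases hZX : Z = X
        · subst hZX
          refine ⟨p, by rw [Function.update_self], fun i => ?_⟩
          rw [updW_same]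
          exact hyp i
        · obtain ⟨p', hp', hw⟩ := h2 Z (by simp [MPLE.freeSO, hZ, hZX])
          refine ⟨p', by rw [Function.update_of_ne hZX]; exact hp', fun i => ?_⟩
          rw [updW_ne _ _ _ _ _ (by omega)]
          exact hw i
    simp only [SatW, MPLE.Sat]
    constructor
    · rintro ⟨y, hd, hy⟩
      obtain ⟨p, hp, hyp⟩ := (Dom_SO K _ (hbd y)).1 hd
      exact ⟨p, hp, (key y p hyp).1 hy⟩
    · rintro ⟨p, hp, hs⟩
      let y : ℕ → Fin (kn K.enc + 1) := fun i =>
        ⟨(p i).val + 1, by rw [kn_enc]; have := (p i).isLt; omega⟩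
      have hyp : ∀ i, (y i).val = (p i).val + 1 := fun i => rfl
      exact ⟨y, (Dom_SO K _ (hbd y)).2 ⟨p, hp, hyp⟩, (key y p hyp).2 hs⟩

end MC

/-- **The MPL[E] model checking problem is decidable**: there is a computable
(total) function that, given (the encoding of) a finite Kripke structure `K`
and a closed MPL[E] formula `φ`, decides whether `K ⊨ φ`. -/
theorem MPLE_model_checking_decidable :
    ∃ f : ℕ → Bool, Computable f ∧
      ∀ (K : FinKripke) (φ : MPLE), φ.Closed →
        (f (Nat.pair K.enc φ.enc) = true ↔ K.Models φ) := by
  refine ⟨fun m => MC.ev (m.unpair.1, m.unpair.2, []), ?_, ?_⟩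
  · exact (MC.prim_ev.comp (Primrec.pair (MC.pu1 Primrec.id)
      (Primrec.pair (MC.pu2 Primrec.id) (Primrec.const [])))).to_comp
  · intro K φ hφ
    simp only [Nat.unpair_pair]
    rw [MC.ev_correct]
    apply MC.SatW_iff
    · intro x hx
      rw [hφ.1] at hx
      exact absurd hx (Finset.notMem_empty x)
    · intro X hX
      rw [hφ.2] at hX
      exact absurd hX (Finset.notMem_empty X)
end

section
/- The model checking problem for HyperQPTL⁺ is undecidable: there is no algorithm that, given a finite Kripke structure K and a HyperQPTL⁺ sentence φ, decides whether Tr(K, s₀) ⊨ φ. -/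
/-!
STATEMENT 6: The model checking problem for HyperQPTL⁺ is undecidable: there
is no algorithm that, given a finite Kripke structure K and a HyperQPTL⁺
sentence φ, decides whether Tr(K, s₀) ⊨ φ.
-/

/-- A trace over the atomic propositions (drawn from `ℕ`). -/
abbrev Trace : Type := ℕ → Set ℕ

/-- Quantifier-free HyperQPTL⁺ formulas: `a_π | ¬ψ | ψ ∨ ψ | X ψ | F ψ`. -/
inductive QF : Type
  | atom : ℕ → ℕ → QF            -- `a_π` (proposition, trace variable)
  | not : QF → QF
  | or : QF → QF → QF
  | next : QF → QF
  | fut : QF → QF                -- `F ψ`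

/-- Satisfaction of a quantifier-free formula w.r.t. a trace assignment `Pi`
and a position `i`. -/
def QF.Sat (Pi : ℕ → Trace) : ℕ → QF → Prop
  | i, .atom a π => a ∈ Pi π i
  | i, .not ψ => ¬ QF.Sat Pi i ψ
  | i, .or ψ₁ ψ₂ => QF.Sat Pi i ψ₁ ∨ QF.Sat Pi i ψ₂
  | i, .next ψ => QF.Sat Pi (i + 1) ψ
  | i, .fut ψ => ∃ k, i ≤ k ∧ QF.Sat Pi k ψ

/-- Trace variables occurring in a quantifier-free formula. -/
def QF.tvars : QF → Finset ℕ
  | .atom _ π => {π}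
  | .not ψ => ψ.tvars
  | .or ψ₁ ψ₂ => ψ₁.tvars ∪ ψ₂.tvars
  | .next ψ => ψ.tvars
  | .fut ψ => ψ.tvars

/-- HyperQPTL⁺ formulas: `∀π.φ | ∃π.φ | ∀a.φ | ∃a.φ | ψ`. Propositional
quantification `∃a`/`∀a` re-interprets the proposition `a` on the existing
traces. -/
inductive HQPlus : Type
  | qf : QF → HQPlus
  | ex : ℕ → HQPlus → HQPlus      -- `∃π.φ`
  | all : ℕ → HQPlus → HQPlus     -- `∀π.φ`
  | pex : ℕ → HQPlus → HQPlus     -- `∃a.φ`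
  | pall : ℕ → HQPlus → HQPlus    -- `∀a.φ`

/-- `T' =_{AP\{a}} T`: `T'` agrees with `T` on all propositions except `a`
(the projections of the two trace sets that remove `a` coincide). -/
def AgreeExcept (a : ℕ) (T T' : Set Trace) : Prop :=
  (fun t : Trace => fun i => t i \ {a}) '' T' =
    (fun t : Trace => fun i => t i \ {a}) '' T

/-- Satisfaction `T, Π, i ⊨ φ` of a HyperQPTL⁺ formula. -/
def HQPlus.Sat : Set Trace → (ℕ → Trace) → ℕ → HQPlus → Prop
  | _, Pi, i, .qf ψ => QF.Sat Pi i ψ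
  | T, Pi, i, .ex π φ => ∃ t ∈ T, HQPlus.Sat T (Function.update Pi π t) i φ
  | T, Pi, i, .all π φ => ∀ t ∈ T, HQPlus.Sat T (Function.update Pi π t) i φ
  | T, Pi, i, .pex a φ =>
      ∃ T' : Set Trace, AgreeExcept a T T' ∧ HQPlus.Sat T' Pi i φ
  | T, Pi, i, .pall a φ =>
      ∀ T' : Set Trace, AgreeExcept a T T' → HQPlus.Sat T' Pi i φ

/-- Free trace variables of a HyperQPTL⁺ formula. -/
def HQPlus.free : HQPlus → Finset ℕ
  | .qf ψ => ψ.tvars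
  | .ex π φ => φ.free \ {π}
  | .all π φ => φ.free \ {π}
  | .pex _ φ => φ.free
  | .pall _ φ => φ.free

/-- A HyperQPTL⁺ sentence is a closed formula. -/
def HQPlus.Closed (φ : HQPlus) : Prop := φ.free = ∅

/-- `T ⊨ φ` iff `T, ∅, 0 ⊨ φ`. -/
def TSat (T : Set Trace) (φ : HQPlus) : Prop :=
  HQPlus.Sat T (fun _ _ => (∅ : Set ℕ)) 0 φ

/-- The set of traces `Tr(K, s₀)`. -/
def FinKripke.Traces (K : FinKripke) : Set Trace :=
  { t | ∃ p, K.IsPath p ∧ t = fun i => ((K.label (p i) : Finset ℕ) : Set ℕ) }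

/-- An explicit (injective) numerical encoding of quantifier-free formulas. -/
def QF.enc : QF → ℕ
  | .atom a π => Nat.pair 0 (Nat.pair a π)
  | .not ψ => Nat.pair 1 ψ.enc
  | .or ψ₁ ψ₂ => Nat.pair 2 (Nat.pair ψ₁.enc ψ₂.enc)
  | .next ψ => Nat.pair 3 ψ.enc
  | .fut ψ => Nat.pair 4 ψ.enc

/-- An explicit (injective) numerical encoding of HyperQPTL⁺ formulas. -/
def HQPlus.enc : HQPlus → ℕ
  | .qf ψ => Nat.pair 0 ψ.enc
  | .ex π φ => Nat.pair 1 (Nat.pair π φ.enc)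
  | .all π φ => Nat.pair 2 (Nat.pair π φ.enc)
  | .pex a φ => Nat.pair 3 (Nat.pair a φ.enc)
  | .pall a φ => Nat.pair 4 (Nat.pair a φ.enc)

open Turing in
theorem hq_trNat_two_pow (n : ℕ) :
    PartrecToTM2.trNat (2 ^ n) = List.replicate n PartrecToTM2.Γ'.bit0 ++ [PartrecToTM2.Γ'.bit1] := by
  have key : ∀ n : ℕ, ∃ p : PosNum, ((2 ^ n : ℕ) : Num) = Num.pos p ∧
      PartrecToTM2.trPosNum p =
        List.replicate n PartrecToTM2.Γ'.bit0 ++ [PartrecToTM2.Γ'.bit1] := by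
    intro n
    induction n with
    | zero => exact ⟨PosNum.one, rfl, rfl⟩
    | succ n ih =>
      obtain ⟨p, hp, hp'⟩ := ih
      refine ⟨PosNum.bit0 p, ?_, ?_⟩
      · have h2 : (2 ^ (n + 1) : ℕ) = 2 * 2 ^ n := by ring
        rw [h2, Nat.cast_mul, hp]
        apply Num.to_nat_inj.1
        have h3 : ((2 : ℕ) : Num) = Num.pos (PosNum.bit0 PosNum.one) := rfl
        rw [h3, Num.mul_to_nat]
        simp [PosNum.cast_bit0]
        omega
      · simp [PartrecToTM2.trPosNum, hp', List.replicate_succ]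
  obtain ⟨p, hp, hp'⟩ := key n
  rw [PartrecToTM2.trNat, hp]
  exact hp'

theorem hq_exists_code : ∃ c : Turing.ToPartrec.Code,
    ¬ ComputablePred fun n : ℕ => (c.eval [2 ^ n]).Dom := by
  have hpow : Primrec₂ (fun a b : ℕ => a ^ b) := Primrec₂.unpaired'.1 Nat.Primrec.pow
  let f : ℕ →. ℕ := fun m => (Nat.rfind fun k => Part.some (decide (2 ^ k = m))).bind
    fun k => Nat.Partrec.Code.eval (Denumerable.ofNat Nat.Partrec.Code k) 0
  have hf : Partrec f := by
    refine Partrec.bind (Partrec.rfind ?_) ?_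
    · refine Computable.partrec ?_
      refine (Primrec.to_comp ?_)
      refine PrimrecPred.decide ?_
      exact Primrec.eq.comp (hpow.comp (Primrec.const 2) Primrec.snd) Primrec.fst
    · exact Nat.Partrec.Code.eval_part.comp
        ((Computable.ofNat _).comp Computable.snd) (Computable.const 0)
  obtain ⟨c, hc⟩ := Turing.ToPartrec.Code.exists_code (Nat.Partrec'.part_iff₁.2 hf)
  refine ⟨c, fun h => ?_⟩
  have hdom : ∀ n : ℕ, (c.eval [2 ^ n]).Dom ↔
      (Nat.Partrec.Code.eval (Denumerable.ofNat Nat.Partrec.Code n) 0).Dom := by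
    intro n
    have h1 := hc ⟨[2 ^ n], rfl⟩
    have h2 : f (2 ^ n) = Nat.Partrec.Code.eval (Denumerable.ofNat Nat.Partrec.Code n) 0 := by
      have : (Nat.rfind fun k => Part.some (decide (2 ^ k = 2 ^ n))) = Part.some n := by
        apply Part.eq_some_iff.2
        refine Nat.mem_rfind.2 ⟨by simp, fun {m} hm => ?_⟩
        have : m ≠ n := hm.ne
        simp [this]
      simp only [f]
      rw [this, Part.bind_some]
    have h3 : c.eval [2 ^ n] = pure <$> f (2 ^ n) := h1
    rw [h3, h2]
    rfl
  apply ComputablePred.halting_problem 0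
  have h' : ComputablePred fun n : ℕ =>
      (Nat.Partrec.Code.eval (Denumerable.ofNat Nat.Partrec.Code n) 0).Dom :=
    h.of_eq hdom
  obtain ⟨g, hg, hg'⟩ := ComputablePred.computable_iff.1 h'
  refine ComputablePred.computable_iff.2 ⟨fun c => g (Encodable.encode c),
    hg.comp Computable.encode, ?_⟩
  funext c
  have := congrFun hg' (Encodable.encode c)
  simpa using this

open Turing in
theorem hq_exists_tm0 : ∃ (Γ Λ : Type) (_ : Inhabited Γ) (_ : Finite Γ) (_ : Inhabited Λ)
    (M : TM0.Machine Γ Λ) (S : Finset Λ) (x y z : Γ), TM0.Supports M (S : Set Λ) ∧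
      ¬ ComputablePred fun n : ℕ => (TM0.eval M (x :: y :: List.replicate n z)).Dom := by
  obtain ⟨c, hc⟩ := hq_exists_code
  let _ : Inhabited PartrecToTM2.Λ' := ⟨PartrecToTM2.trNormal c PartrecToTM2.Cont'.halt⟩
  let M1 := TM2to1.tr PartrecToTM2.tr
  have hs := PartrecToTM2.tr_supports c PartrecToTM2.Cont'.halt
  have hs1 := TM2to1.tr_supports PartrecToTM2.tr hs
  have hs0 := TM1to0.tr_supports M1 hs1
  have finK : Finite PartrecToTM2.K' := by
    refine Finite.of_surjective (fun i : Fin 4 => match i with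
      | 0 => PartrecToTM2.K'.main | 1 => PartrecToTM2.K'.rev
      | 2 => PartrecToTM2.K'.aux | 3 => PartrecToTM2.K'.stack) ?_
    intro k
    cases k
    exacts [⟨0, rfl⟩, ⟨1, rfl⟩, ⟨2, rfl⟩, ⟨3, rfl⟩]
  let s : PartrecToTM2.Γ' → TM2to1.Γ' PartrecToTM2.K' (fun _ => PartrecToTM2.Γ') := fun a =>
    (false, Function.update (fun _ => none) PartrecToTM2.K'.main (some a))
  refine ⟨_, _, inferInstance, ?_, inferInstance, TM1to0.tr M1, TM1to0.trStmts M1 _,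
    (true, (s PartrecToTM2.Γ'.cons).2), s PartrecToTM2.Γ'.bit1, s PartrecToTM2.Γ'.bit0, hs0, ?_⟩
  · unfold TM2to1.Γ'
    infer_instance
  · intro h
    apply hc
    refine h.of_eq fun n => ?_
    have h1 : (true, (s PartrecToTM2.Γ'.cons).2) :: s PartrecToTM2.Γ'.bit1 ::
        List.replicate n (s PartrecToTM2.Γ'.bit0) =
        TM2to1.trInit PartrecToTM2.K'.main (PartrecToTM2.trList [2 ^ n]) := by
      have h5 : (PartrecToTM2.trList [2 ^ n]).reverse = PartrecToTM2.Γ'.cons ::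
          PartrecToTM2.Γ'.bit1 :: List.replicate n PartrecToTM2.Γ'.bit0 := by
        simp [PartrecToTM2.trList, hq_trNat_two_pow]
      have h6 : List.replicate n (s PartrecToTM2.Γ'.bit0) =
          (List.replicate n PartrecToTM2.Γ'.bit0).map s := List.map_replicate.symm
      rw [TM2to1.trInit, h5]
      exact congrArg (fun l => (true, (s PartrecToTM2.Γ'.cons).2) :: s PartrecToTM2.Γ'.bit1 :: l) h6
    refine (iff_of_eq (congrArg (fun l => (TM0.eval (TM1to0.tr M1) l).Dom) h1)).trans ?_
    rw [TM1to0.tr_eval]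
    refine (TM2to1.tr_eval_dom PartrecToTM2.tr _ _).trans ?_
    have h2 := PartrecToTM2.tr_eval c [2 ^ n]
    have h3 : (TM2.init PartrecToTM2.K'.main (PartrecToTM2.trList [2 ^ n]) :
        TM2.Cfg (fun _ : PartrecToTM2.K' => PartrecToTM2.Γ') PartrecToTM2.Λ'
          (Option PartrecToTM2.Γ')) = PartrecToTM2.init c [2 ^ n] := by
      unfold TM2.init PartrecToTM2.init
      congr 1
      funext k
      cases k <;> rfl
    unfold TM2.eval
    rw [h3, h2]
    rfl
/-! ### Derived connectives -/

namespace HQ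

def qand (a b : QF) : QF := .not (.or (.not a) (.not b))
def qimp (a b : QF) : QF := .or (.not a) b
def qiff (a b : QF) : QF := qand (qimp a b) (qimp b a)
def qglob (a : QF) : QF := .not (.fut (.not a))
def qtt : QF := .or (.atom 0 0) (.not (.atom 0 0))
def qff : QF := .not qtt
def qconj {α : Type} (l : List α) (f : α → QF) : QF := l.foldr (fun a b => qand (f a) b) qtt

variable (Pi : ℕ → Trace) (i : ℕ)

@[simp] theorem sat_atom (a π : ℕ) : QF.Sat Pi i (.atom a π) ↔ a ∈ Pi π i := by simp [QF.Sat]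
@[simp] theorem sat_not (a : QF) : QF.Sat Pi i (.not a) ↔ ¬ QF.Sat Pi i a := by simp [QF.Sat]
@[simp] theorem sat_next (a : QF) : QF.Sat Pi i (.next a) ↔ QF.Sat Pi (i + 1) a := by
  simp [QF.Sat]
@[simp] theorem sat_and (a b : QF) :
    QF.Sat Pi i (qand a b) ↔ QF.Sat Pi i a ∧ QF.Sat Pi i b := by
  simp only [qand, QF.Sat]; tauto
@[simp] theorem sat_imp (a b : QF) :
    QF.Sat Pi i (qimp a b) ↔ (QF.Sat Pi i a → QF.Sat Pi i b) := by
  simp only [qimp, QF.Sat]; tauto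
@[simp] theorem sat_iff (a b : QF) :
    QF.Sat Pi i (qiff a b) ↔ (QF.Sat Pi i a ↔ QF.Sat Pi i b) := by
  simp only [qiff, sat_and, sat_imp]; tauto
@[simp] theorem sat_glob (a : QF) :
    QF.Sat Pi i (qglob a) ↔ ∀ j, QF.Sat Pi (i + j) a := by
  simp only [qglob, QF.Sat]
  push Not
  exact ⟨fun h j => h _ (Nat.le_add_right _ _), fun h k hk => by
    obtain ⟨j, rfl⟩ := Nat.exists_eq_add_of_le hk
    exact h j⟩
@[simp] theorem sat_tt : QF.Sat Pi i qtt := by simp only [qtt, QF.Sat]; tauto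
@[simp] theorem sat_ff : ¬ QF.Sat Pi i qff := by simp [qff]
@[simp] theorem sat_conj {α : Type} (l : List α) (f : α → QF) :
    QF.Sat Pi i (qconj l f) ↔ ∀ a ∈ l, QF.Sat Pi i (f a) := by
  induction l with
  | nil => simp [qconj]
  | cons a l ih =>
    have : qconj (a :: l) f = qand (f a) (qconj l f) := rfl
    rw [this, sat_and, ih]
    simp

/-- All trace variables are among `0, 1, 2`. -/
def Ok (ψ : QF) : Prop := ψ.tvars ⊆ {0, 1, 2}

theorem ok_atom {a π : ℕ} (h : π ≤ 2) : Ok (.atom a π) := by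
  intro x hx
  simp only [QF.tvars, Finset.mem_singleton] at hx
  subst hx
  interval_cases x <;> simp
theorem ok_not {a : QF} (h : Ok a) : Ok (.not a) := h
theorem ok_next {a : QF} (h : Ok a) : Ok (.next a) := h
theorem ok_or {a b : QF} (h : Ok a) (h' : Ok b) : Ok (.or a b) := Finset.union_subset h h'
theorem ok_and {a b : QF} (h : Ok a) (h' : Ok b) : Ok (qand a b) := Finset.union_subset h h'
theorem ok_imp {a b : QF} (h : Ok a) (h' : Ok b) : Ok (qimp a b) := Finset.union_subset h h'
theorem ok_iff {a b : QF} (h : Ok a) (h' : Ok b) : Ok (qiff a b) :=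
  ok_and (ok_imp h h') (ok_imp h' h)
theorem ok_glob {a : QF} (h : Ok a) : Ok (qglob a) := h
theorem ok_tt : Ok qtt := ok_or (ok_atom (by omega)) (ok_not (ok_atom (by omega)))
theorem ok_ff : Ok qff := ok_tt
theorem ok_conj {α : Type} {l : List α} {f : α → QF} (h : ∀ a, Ok (f a)) : Ok (qconj l f) := by
  induction l with
  | nil => exact ok_tt
  | cons a l ih => exact ok_and (h a) ih

end HQ

namespace HQ

/-! ### Existential quantification over the propositions `0, …, k-1` -/

def pexs : ℕ → HQPlus → HQPlus
  | 0, φ => φ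
  | k + 1, φ => .pex k (pexs k φ)

theorem free_pexs (k : ℕ) (φ : HQPlus) : (pexs k φ).free = φ.free := by
  induction k with
  | zero => rfl
  | succ k ih => exact ih

theorem of_sat_pexs {k : ℕ} {φ : HQPlus} {T : Set Trace} {Pi : ℕ → Trace} {i : ℕ}
    (h : HQPlus.Sat T Pi i (pexs k φ)) : ∃ T', HQPlus.Sat T' Pi i φ := by
  induction k generalizing T with
  | zero => exact ⟨T, h⟩
  | succ k ih =>
    obtain ⟨T', -, h'⟩ := h
    exact ih h'

theorem sat_pexs {φ : HQPlus} {T : Set Trace} {Pi : ℕ → Trace} {i : ℕ}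
    (h : HQPlus.Sat T Pi i φ) (k : ℕ) :
    HQPlus.Sat ((fun t : Trace => fun i => t i \ Set.Iio k) '' T) Pi i (pexs k φ) := by
  induction k with
  | zero => simpa [pexs] using h
  | succ k ih =>
    refine ⟨_, ?_, ih⟩
    unfold AgreeExcept
    rw [Set.image_image, Set.image_image]
    apply Set.image_congr
    intro t _
    funext j
    ext x
    simp only [Set.mem_sdiff, Set.mem_Iio, Set.mem_singleton_iff]
    constructor <;> rintro ⟨⟨h1, h2⟩, h3⟩ <;> refine ⟨⟨h1, ?_⟩, h3⟩ <;> omega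

def K1 : FinKripke where
  n := 1
  init := 0
  trans := fun _ => {0}
  trans_nonempty := fun _ => ⟨0, by simp⟩
  label := fun _ => ∅

theorem K1_traces : K1.Traces = {fun _ => ∅} := by
  ext t
  simp only [FinKripke.Traces, Set.mem_ofPred_eq, Set.mem_singleton_iff]
  constructor
  · rintro ⟨p, -, rfl⟩
    funext i
    simp [K1]
  · rintro rfl
    refine ⟨fun _ => K1.init, ⟨rfl, fun _ => ?_⟩, ?_⟩
    · exact Finset.mem_singleton_self _
    · funext i
      simp [K1]

theorem K1_sat {φ : HQPlus} {k : ℕ} :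
    TSat K1.Traces (pexs k φ) → ∃ T, HQPlus.Sat T (fun _ _ => ∅) 0 φ := of_sat_pexs

theorem K1_sat' {φ : HQPlus} {k : ℕ} {T : Set Trace} (hT : T.Nonempty)
    (hk : ∀ t ∈ T, ∀ i, ∀ a ∈ t i, a < k) (h : HQPlus.Sat T (fun _ _ => ∅) 0 φ) :
    TSat K1.Traces (pexs k φ) := by
  have := sat_pexs h k
  rw [TSat, K1_traces]
  convert this
  symm
  ext t
  simp only [Set.mem_image, Set.mem_singleton_iff]
  have key : ∀ t ∈ T, (fun i => t i \ Set.Iio k) = fun _ => (∅ : Set ℕ) := by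
    intro t ht
    funext i
    ext a
    simp only [Set.mem_sdiff, Set.mem_Iio, Set.mem_empty_iff_false, iff_false, not_and, not_not]
    exact hk t ht i a
  constructor
  · rintro ⟨t, ht, rfl⟩
    exact key t ht
  · rintro rfl
    obtain ⟨t, ht⟩ := hT
    exact ⟨t, ht, key t ht⟩

end HQ
namespace HQ

/-! ### Encoding Turing machines -/

section Machine

open Turing

variable {Γ Λ : Type} [Inhabited Γ] [Inhabited Λ] (M : TM0.Machine Γ Λ)
  (ls : List Λ) (lg : List Γ) (iq : Λ → ℕ) (ig : Γ → ℕ)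

/-- The trace `t` represents the configuration `c`. -/
def Rep (c : TM0.Cfg Γ Λ) (t : Trace) : Prop :=
  (∀ q ∈ ls, (3 * iq q ∈ t 0 ↔ q = c.q)) ∧
  (∀ g (i : ℕ), (3 * ig g + 1 ∈ t i ↔ g = c.Tape.nth i)) ∧
  (∀ g (i : ℕ), (3 * ig g + 2 ∈ t i ↔ g = c.Tape.nth (-((i : ℤ) + 1))))

/-- The canonical trace of a configuration. -/
def canon (c : TM0.Cfg Γ Λ) : Trace := fun i =>
  {3 * iq c.q, 3 * ig (c.Tape.nth i) + 1, 3 * ig (c.Tape.nth (-((i : ℤ) + 1))) + 2}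

theorem rep_canon (hq : Set.InjOn iq {q | q ∈ ls}) (hg : Function.Injective ig)
    (c : TM0.Cfg Γ Λ) (hc : c.q ∈ ls) : Rep ls iq ig c (canon iq ig c) := by
  refine ⟨fun q hqs => ?_, fun g i => ?_, fun g i => ?_⟩
  · simp only [canon, Set.mem_insert_iff, Set.mem_singleton_iff]
    constructor
    · intro h
      exact hq hqs hc (by omega)
    · rintro rfl
      exact Or.inl rfl
  · simp only [canon, Set.mem_insert_iff, Set.mem_singleton_iff]
    constructor
    · intro h
      exact hg (by omega)
    · rintro rfl
      exact Or.inr (Or.inl rfl)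
  · simp only [canon, Set.mem_insert_iff, Set.mem_singleton_iff]
    constructor
    · intro h
      exact hg (by omega)
    · rintro rfl
      exact Or.inr (Or.inr rfl)

def aq (q : Λ) (π : ℕ) : QF := .atom (3 * iq q) π
def ar (g : Γ) (π : ℕ) : QF := .atom (3 * ig g + 1) π
def al (g : Γ) (π : ℕ) : QF := .atom (3 * ig g + 2) π

open Classical in
/-- A literal: `ψ` if `p` and `¬ ψ` otherwise. -/
noncomputable def lit (p : Prop) (ψ : QF) : QF := if p then ψ else .not ψ

theorem sat_lit (Pi : ℕ → Trace) (i : ℕ) (p : Prop) (ψ : QF) :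
    QF.Sat Pi i (lit p ψ) ↔ (QF.Sat Pi i ψ ↔ p) := by
  unfold lit
  split_ifs with h <;> simp [h]

theorem ok_lit {p : Prop} {ψ : QF} (h : Ok ψ) : Ok (lit p ψ) := by
  unfold lit
  split_ifs
  exacts [h, ok_not h]

noncomputable def stateIs (q : Λ) (π : ℕ) : QF := qconj ls fun q' => lit (q' = q) (aq iq q' π)
noncomputable def symIs (g : Γ) (π : ℕ) : QF := qconj lg fun g' => lit (g' = g) (ar ig g' π)
noncomputable def leftIs (g : Γ) (π : ℕ) : QF := qconj lg fun g' => lit (g' = g) (al ig g' π)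

noncomputable def bodyF : Option (Λ × TM0.Stmt Γ) → QF
  | none => qff
  | some (q, .move .right) => qand (stateIs ls iq q 2) (qconj lg fun g =>
      qand (qglob (qiff (.next (ar ig g 1)) (ar ig g 2)))
        (qand (qglob (qiff (al ig g 1) (.next (al ig g 2)))) (qiff (ar ig g 1) (al ig g 2))))
  | some (q, .move .left) => qand (stateIs ls iq q 2) (qconj lg fun g =>
      qand (qglob (qiff (ar ig g 1) (.next (ar ig g 2))))
        (qand (qglob (qiff (.next (al ig g 1)) (al ig g 2))) (qiff (al ig g 1) (ar ig g 2))))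
  | some (q, .write a) => qand (stateIs ls iq q 2) (qand (symIs lg ig a 2) (qconj lg fun g =>
      qand (qglob (qiff (.next (ar ig g 1)) (.next (ar ig g 2))))
        (qglob (qiff (al ig g 1) (al ig g 2)))))

noncomputable def stepF : QF := qconj ls fun q => qconj lg fun g =>
  qimp (qand (aq iq q 1) (ar ig g 1)) (bodyF ls lg iq ig (M q g))

/-- The tape is the given list. -/
noncomputable def listF : List Γ → QF
  | [] => qglob (symIs lg ig default 0)
  | g :: l => qand (symIs lg ig g 0) (.next (listF l))

noncomputable def initF (l : List Γ) : QF :=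
  qand (qand (stateIs ls iq default 0) (qglob (leftIs lg ig default 0))) (listF lg ig l)

noncomputable def mainF (l : List Γ) : HQPlus :=
  .ex 0 (.all 1 (.ex 2 (.qf (qand (stepF M ls lg iq ig) (initF ls lg iq ig l)))))

theorem ok_stateIs (q : Λ) {π : ℕ} (h : π ≤ 2) : Ok (stateIs ls iq q π) :=
  ok_conj fun _ => ok_lit (ok_atom h)
theorem ok_symIs (g : Γ) {π : ℕ} (h : π ≤ 2) : Ok (symIs lg ig g π) :=
  ok_conj fun _ => ok_lit (ok_atom h)
theorem ok_leftIs (g : Γ) {π : ℕ} (h : π ≤ 2) : Ok (leftIs lg ig g π) :=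
  ok_conj fun _ => ok_lit (ok_atom h)
theorem ok_ar (g : Γ) {π : ℕ} (h : π ≤ 2) : Ok (ar ig g π) := ok_atom h
theorem ok_al (g : Γ) {π : ℕ} (h : π ≤ 2) : Ok (al ig g π) := ok_atom h

theorem ok_bodyF (o : Option (Λ × TM0.Stmt Γ)) : Ok (bodyF ls lg iq ig o) := by
  have h1 : (1 : ℕ) ≤ 2 := by omega
  have h2 : (2 : ℕ) ≤ 2 := le_rfl
  have r1 := fun g => ok_ar ig (g : Γ) h1
  have r2 := fun g => ok_ar ig (g : Γ) h2
  have l1 := fun g => ok_al ig (g : Γ) h1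
  have l2 := fun g => ok_al ig (g : Γ) h2
  rcases o with _ | ⟨q, (_ | _) | a⟩
  · exact ok_ff
  · exact ok_and (ok_stateIs _ _ _ h2) (ok_conj fun g => ok_and (ok_glob (ok_iff (r1 g) (r2 g)))
      (ok_and (ok_glob (ok_iff (l1 g) (l2 g))) (ok_iff (l1 g) (r2 g))))
  · exact ok_and (ok_stateIs _ _ _ h2) (ok_conj fun g => ok_and (ok_glob (ok_iff (r1 g) (r2 g)))
      (ok_and (ok_glob (ok_iff (l1 g) (l2 g))) (ok_iff (r1 g) (l2 g))))
  · exact ok_and (ok_stateIs _ _ _ h2) (ok_and (ok_symIs _ _ _ h2) (ok_conj fun g =>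
      ok_and (ok_glob (ok_iff (r1 g) (r2 g))) (ok_glob (ok_iff (l1 g) (l2 g)))))

theorem ok_listF (l : List Γ) : Ok (listF lg ig l) := by
  induction l with
  | nil => exact ok_symIs lg ig _ (by omega)
  | cons g l ih => exact ok_and (ok_symIs _ _ _ (by omega)) ih

theorem ok_matrix (l : List Γ) : Ok (qand (stepF M ls lg iq ig) (initF ls lg iq ig l)) := by
  refine ok_and (ok_conj fun q => ok_conj fun g => ok_imp (ok_and (ok_atom (by omega))
    (ok_atom (by omega))) (ok_bodyF _ _ _ _ _)) (ok_and (ok_and (ok_stateIs _ _ _ (by omega))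
      (ok_leftIs lg ig _ (by omega))) (ok_listF _ _ _))

theorem closed_mainF (l : List Γ) : (mainF M ls lg iq ig l).free = ∅ := by
  have := ok_matrix M ls lg iq ig l
  simp only [mainF, HQPlus.free]
  ext x
  simp only [Finset.mem_sdiff, Finset.mem_singleton, Finset.notMem_empty, iff_false]
  rintro ⟨⟨⟨h, h2⟩, h1⟩, h0⟩
  have := this h
  simp at this
  omega

variable {M ls lg iq ig}

theorem sat_stateIs {Pi : ℕ → Trace} {i : ℕ} {q : Λ} {π : ℕ} :
    QF.Sat Pi i (stateIs ls iq q π) ↔ ∀ q' ∈ ls, (3 * iq q' ∈ Pi π i ↔ q' = q) := by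
  simp [stateIs, sat_lit, aq]

theorem sat_symIs (hlg : ∀ g, g ∈ lg) {Pi : ℕ → Trace} {i : ℕ} {g : Γ} {π : ℕ} :
    QF.Sat Pi i (symIs lg ig g π) ↔ ∀ g', (3 * ig g' + 1 ∈ Pi π i ↔ g' = g) := by
  simp [symIs, sat_lit, ar, hlg]

theorem sat_leftIs (hlg : ∀ g, g ∈ lg) {Pi : ℕ → Trace} {i : ℕ} {g : Γ} {π : ℕ} :
    QF.Sat Pi i (leftIs lg ig g π) ↔ ∀ g', (3 * ig g' + 2 ∈ Pi π i ↔ g' = g) := by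
  simp [leftIs, sat_lit, al, hlg]

theorem sat_listF (hlg : ∀ g, g ∈ lg) {Pi : ℕ → Trace} {i : ℕ} {l : List Γ} :
    QF.Sat Pi i (listF lg ig l) ↔
      ∀ (j : ℕ) g, (3 * ig g + 1 ∈ Pi 0 (i + j) ↔ g = l.getI j) := by
  induction l generalizing i with
  | nil => simp [listF, sat_symIs hlg]
  | cons a l ih =>
    simp only [listF, sat_and, sat_next, sat_symIs hlg, ih]
    constructor
    · rintro ⟨h1, h2⟩ (_ | j) g
      · simpa using h1 g
      · have := h2 j g
        rw [add_assoc, add_comm 1 j] at this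
        simpa using this
    · intro h
      refine ⟨fun g => by simpa using h 0 g, fun j g => ?_⟩
      have := h (j + 1) g
      rw [add_assoc, add_comm 1 j]
      simpa using this

theorem sat_initF (hlg : ∀ g, g ∈ lg) {Pi : ℕ → Trace} {l : List Γ} :
    QF.Sat Pi 0 (initF ls lg iq ig l) ↔ Rep ls iq ig (TM0.init l) (Pi 0) := by
  have hR : ∀ j : ℕ, (Tape.mk₁ l).nth j = l.getI j := by
    intro j
    rw [Tape.mk₁, Tape.mk₂, Tape.mk'_nth_nat, ListBlank.nth_mk]
  have hL : ∀ j : ℕ, (Tape.mk₁ l).nth (-((j : ℤ) + 1)) = default := by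
    intro j
    have : (Tape.mk₁ l).nth (-((j : ℤ) + 1)) = (Tape.mk₁ l).left.nth j := rfl
    rw [this, Tape.mk₁, Tape.mk₂, Tape.mk'_left, ListBlank.nth_mk]
    simp
  simp only [initF, sat_and, sat_glob, sat_stateIs, sat_leftIs hlg, sat_listF hlg, Rep, TM0.init,
    hR, hL, zero_add]
  constructor
  · rintro ⟨⟨h1, h2⟩, h3⟩
    exact ⟨h1, fun g i => h3 i g, fun g i => h2 i g⟩
  · rintro ⟨h1, h3, h2⟩
    exact ⟨⟨h1, fun i g => h2 g i⟩, fun i g => h3 g i⟩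

theorem sat_stepF (hlg : ∀ g, g ∈ lg) {Pi : ℕ → Trace} {c : TM0.Cfg Γ Λ}
    (hc : c.q ∈ ls) (hr : Rep ls iq ig c (Pi 1)) :
    QF.Sat Pi 0 (stepF M ls lg iq ig) ↔
      ∃ c', TM0.step M c = some c' ∧ Rep ls iq ig c' (Pi 2) := by
  obtain ⟨q, T⟩ := c
  obtain ⟨hr1, hr2, hr3⟩ := hr
  have h1 : QF.Sat Pi 0 (stepF M ls lg iq ig) ↔ QF.Sat Pi 0 (bodyF ls lg iq ig (M q T.1)) := by
    simp only [stepF, sat_conj, sat_imp, sat_and, aq, ar, sat_atom]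
    constructor
    · intro h
      exact h q hc T.1 (hlg _) ⟨(hr1 q hc).2 rfl, (hr2 _ 0).2 rfl⟩
    · rintro h q' hq' g - ⟨h2, h3⟩
      have e1 := (hr1 q' hq').1 h2
      have e2 : g = T.1 := (hr2 _ 0).1 h3
      simp only at e1
      subst e1 e2
      exact h
  rw [h1]
  simp only at hr1 hr2 hr3
  have hr0 : ∀ g, 3 * ig g + 1 ∈ Pi 1 0 ↔ g = T.nth 0 := fun g => by simpa using hr2 g 0
  have hl0 : ∀ g, 3 * ig g + 2 ∈ Pi 1 0 ↔ g = T.nth (-1) := fun g => by simpa using hr3 g 0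
  rcases hM : M q T.1 with _ | ⟨q', (_ | _) | a⟩
  · simp [bodyF, TM0.step, hM]
  · simp only [bodyF, TM0.step, hM, Option.map_some, Option.some.injEq, exists_eq_left',
      Rep, Tape.move_left_nth, sat_and, sat_conj, sat_glob, sat_iff, sat_next, ar, al, sat_atom,
      sat_stateIs, hlg, true_imp_iff, zero_add, hr2, hr3, hr0, hl0]
    refine and_congr_right fun _ => ?_
    constructor
    · intro h
      refine ⟨fun g i => ?_, fun g i => ?_⟩
      · rcases i with _ | i
        · simpa using (h g).2.2.symm
        · rw [← (h g).1 i]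
          simp
      · rw [← (h g).2.1 i]
        push_cast
        ring_nf
    · rintro ⟨h1, h2⟩ g
      refine ⟨fun i => ?_, fun i => ?_, ?_⟩
      · rw [h1]; simp
      · rw [h2]; push_cast; ring_nf
      · rw [h1]; simp
  · simp only [bodyF, TM0.step, hM, Option.map_some, Option.some.injEq, exists_eq_left',
      Rep, Tape.move_right_nth, sat_and, sat_conj, sat_glob, sat_iff, sat_next, ar, al, sat_atom,
      sat_stateIs, hlg, true_imp_iff, zero_add, hr2, hr3, hr0, hl0]
    refine and_congr_right fun _ => ?_
    constructor
    · intro h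
      refine ⟨fun g i => ?_, fun g i => ?_⟩
      · rw [← (h g).1 i]
        simp
      · rcases i with _ | i
        · simpa using (h g).2.2.symm
        · rw [← (h g).2.1 i]
          push_cast
          ring_nf
    · rintro ⟨h1, h2⟩ g
      refine ⟨fun i => ?_, fun i => ?_, ?_⟩
      · rw [h1]; simp
      · rw [h2]; push_cast; ring_nf
      · rw [h2]; simp
  · simp only [bodyF, TM0.step, hM, Option.map_some, Option.some.injEq, exists_eq_left',
      Rep, Tape.write_nth, sat_and, sat_conj, sat_glob, sat_iff, sat_next, ar, al, sat_atom,
      sat_stateIs, sat_symIs hlg, hlg, true_imp_iff, zero_add, hr2, hr3]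
    refine and_congr_right fun _ => ?_
    have hne : ∀ i : ℕ, ((i + 1 : ℕ) : ℤ) ≠ 0 := by intro i; omega
    have hne' : ∀ i : ℕ, -((i : ℤ) + 1) ≠ 0 := by intro i; omega
    constructor
    · rintro ⟨h0, h⟩
      refine ⟨fun g i => ?_, fun g i => ?_⟩
      · rcases i with _ | i
        · simpa using h0 g
        · rw [← (h g).1 i, if_neg (hne i)]
      · rw [← (h g).2 i, if_neg (hne' i)]
    · rintro ⟨h1, h2⟩
      refine ⟨fun g => by simpa using h1 g 0, fun g => ⟨fun i => ?_, fun i => ?_⟩⟩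
      · rw [h1, if_neg (hne i)]
      · rw [h2, if_neg (hne' i)]

/-- The main reduction. -/
theorem reduction (hs : TM0.Supports M {q | q ∈ ls}) (hlg : ∀ g, g ∈ lg)
    (hq : Set.InjOn iq {q | q ∈ ls}) (hg : Function.Injective ig) {B : ℕ}
    (hqB : ∀ q ∈ ls, iq q < B) (hgB : ∀ g, ig g < B) (l : List Γ) :
    TSat K1.Traces (pexs (3 * B) (mainF M ls lg iq ig l)) ↔ ¬ (TM0.eval M l).Dom := by
  have hdom : (TM0.eval M l).Dom ↔ ∃ c, StateTransition.Reaches (TM0.step M) (TM0.init l) c ∧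
      TM0.step M c = none := by
    constructor
    · intro h
      have h' : (StateTransition.eval (TM0.step M) (TM0.init l)).Dom := h
      exact ⟨_, StateTransition.mem_eval.1 (Part.get_mem h')⟩
    · rintro ⟨c, hc⟩
      exact (Part.dom_iff_mem.2 ⟨c, StateTransition.mem_eval.2 hc⟩ :
        (StateTransition.eval (TM0.step M) (TM0.init l)).Dom)
  have hin : ∀ c, StateTransition.Reaches (TM0.step M) (TM0.init l) c → c.q ∈ ls := by
    intro c hc
    induction hc with
    | refl => exact hs.1
    | tail _ h ih => exact TM0.step_supports M hs h ih
  rw [hdom]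
  constructor
  · intro h
    obtain ⟨T, t0, ht0, h⟩ := K1_sat h
    rintro ⟨c, hc, hn⟩
    have key : ∀ c, StateTransition.Reaches (TM0.step M) (TM0.init l) c →
        ∃ t ∈ T, Rep ls iq ig c t := by
      intro c hc
      induction hc with
      | refl =>
        obtain ⟨t2, -, h2⟩ := h t0 ht0
        have h3 := ((sat_and _ _ _ _).1 h2).2
        rw [sat_initF hlg] at h3
        exact ⟨t0, ht0, by simpa using h3⟩
      | @tail b c' hb h' ih =>
        obtain ⟨t, ht, hrep⟩ := ih
        obtain ⟨t2, ht2, h2⟩ := h t ht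
        have h3 := ((sat_and _ _ _ _).1 h2).1
        rw [sat_stepF hlg (hin b hb) (by simpa using hrep)] at h3
        obtain ⟨c'', e, hr⟩ := h3
        have e2 : TM0.step M b = some c' := h'
        rw [e] at e2
        cases e2
        exact ⟨t2, ht2, by simpa using hr⟩
    obtain ⟨t, ht, hrep⟩ := key c hc
    obtain ⟨t2, ht2, h2⟩ := h t ht
    have h3 := ((sat_and _ _ _ _).1 h2).1
    rw [sat_stepF hlg (hin c hc) (by simpa using hrep)] at h3
    obtain ⟨c'', e, -⟩ := h3
    rw [hn] at e
    cases e
  · intro h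
    push Not at h
    have r0 : StateTransition.Reaches (TM0.step M) (TM0.init l) (TM0.init l) :=
      Relation.ReflTransGen.refl
    refine K1_sat' (T := (canon iq ig) '' {c | StateTransition.Reaches (TM0.step M)
      (TM0.init l) c}) ⟨_, _, r0, rfl⟩ ?_ ?_
    · rintro _ ⟨c, hc, rfl⟩ i a ha
      have h1 := hqB _ (hin c hc)
      have h2 := hgB (c.Tape.nth i)
      have h3 := hgB (c.Tape.nth (-((i : ℤ) + 1)))
      simp only [canon, Set.mem_insert_iff, Set.mem_singleton_iff] at ha
      omega
    · refine ⟨_, ⟨_, r0, rfl⟩, ?_⟩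
      rintro _ ⟨c, hc, rfl⟩
      obtain ⟨c', hc'⟩ := Option.ne_none_iff_exists'.1 (h c hc)
      have rc' : StateTransition.Reaches (TM0.step M) (TM0.init l) c' :=
        Relation.ReflTransGen.tail hc hc'
      refine ⟨_, ⟨c', rc', rfl⟩, ?_⟩
      refine (sat_and _ _ _ _).2 ⟨?_, ?_⟩
      · rw [sat_stepF hlg (hin c hc) (by simpa using rep_canon _ _ _ hq hg c (hin c hc))]
        exact ⟨c', hc', by simpa using rep_canon _ _ _ hq hg c' (hin c' rc')⟩
      · rw [sat_initF hlg]
        simpa using rep_canon _ _ _ hq hg _ (hin _ r0)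

end Machine

end HQ

namespace HQ

open Turing

theorem primrec_qand {f g : ℕ → QF} (hf : Primrec fun n => (f n).enc)
    (hg : Primrec fun n => (g n).enc) : Primrec fun n => (qand (f n) (g n)).enc := by
  have p1 : Primrec fun n => Nat.pair 1 (f n).enc := Primrec₂.natPair.comp (.const 1) hf
  have p2 : Primrec fun n => Nat.pair 1 (g n).enc := Primrec₂.natPair.comp (.const 1) hg
  exact Primrec₂.natPair.comp (.const 1)
    (Primrec₂.natPair.comp (.const 2) (Primrec₂.natPair.comp p1 p2))

theorem primrec_next {f : ℕ → QF} (hf : Primrec fun n => (f n).enc) :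
    Primrec fun n => (QF.next (f n)).enc :=
  Primrec₂.natPair.comp (.const 3) hf

theorem primrec_pexs {f : ℕ → HQPlus} (hf : Primrec fun n => (f n).enc) (k : ℕ) :
    Primrec fun n => (pexs k (f n)).enc := by
  induction k with
  | zero => exact hf
  | succ k ih => exact Primrec₂.natPair.comp (.const 3) (Primrec₂.natPair.comp (.const k) ih)

theorem primrec_listF {Γ : Type} [Inhabited Γ] (lg : List Γ) (ig : Γ → ℕ) (z : Γ) :
    Primrec fun n : ℕ => (listF lg ig (List.replicate n z)).enc := by
  have step : Primrec fun m : ℕ => Nat.pair 1 (Nat.pair 2 (Nat.pair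
      (Nat.pair 1 (symIs lg ig z 0).enc) (Nat.pair 1 (Nat.pair 3 m)))) :=
    Primrec₂.natPair.comp (.const 1) (Primrec₂.natPair.comp (.const 2)
      (Primrec₂.natPair.comp (.const _) (Primrec₂.natPair.comp (.const 1)
        (Primrec₂.natPair.comp (.const 3) .id))))
  have h := Primrec.nat_rec₁ (listF lg ig ([] : List Γ)).enc
    (step.comp (Primrec.snd (α := ℕ) (β := ℕ))).to₂
  refine h.of_eq fun n => ?_
  induction n with
  | zero => rfl
  | succ n ih =>
    simp only [List.replicate_succ, listF]
    simp only [qand, QF.enc]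
    rw [← ih]
    rfl

theorem primrec_mainF {Γ Λ : Type} [Inhabited Γ] [Inhabited Λ] (M : TM0.Machine Γ Λ)
    (ls : List Λ) (lg : List Γ) (iq : Λ → ℕ) (ig : Γ → ℕ) (x y z : Γ) (k : ℕ) :
    Primrec fun n : ℕ => (pexs k (mainF M ls lg iq ig (x :: y :: List.replicate n z))).enc := by
  apply primrec_pexs
  have h1 := primrec_qand (f := fun _ => symIs lg ig y 0) (.const _)
    (primrec_next (primrec_listF lg ig z))
  have h2 := primrec_qand (f := fun _ => symIs lg ig x 0) (.const _) (primrec_next h1)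
  have h3 := primrec_qand (f := fun _ => stepF M ls lg iq ig) (.const _)
    (primrec_qand (f := fun _ => qand (stateIs ls iq default 0)
      (qglob (leftIs lg ig default 0))) (.const _) h2)
  exact Primrec₂.natPair.comp (.const 1) (Primrec₂.natPair.comp (.const 0)
    (Primrec₂.natPair.comp (.const 2) (Primrec₂.natPair.comp (.const 1)
      (Primrec₂.natPair.comp (.const 1) (Primrec₂.natPair.comp (.const 2)
        (Primrec₂.natPair.comp (.const 0) h3))))))

end HQ

/-- **The HyperQPTL⁺ model checking problem is undecidable**: there is no
computable (total) function that, given (the encoding of) a finite Kripke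
structure `K` and a HyperQPTL⁺ sentence `φ`, decides whether
`Tr(K, s₀) ⊨ φ`. -/
theorem hyperQPTLplus_model_checking_undecidable :
    ¬ ∃ f : ℕ → Bool, Computable f ∧
        ∀ (K : FinKripke) (φ : HQPlus), φ.Closed →
          (f (Nat.pair K.enc φ.enc) = true ↔ TSat K.Traces φ) := by
  classical
  rintro ⟨f, hf, hspec⟩
  obtain ⟨Γ, Λ, _, _, _, M, S, x, y, z, hsup, hnc⟩ := hq_exists_tm0
  apply hnc
  have := Fintype.ofFinite Γ
  let ls : List Λ := S.toList
  let lg : List Γ := (Finset.univ : Finset Γ).toList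
  let iq : Λ → ℕ := fun q => ls.idxOf q
  let ig : Γ → ℕ := fun g => lg.idxOf g
  have hlg : ∀ g, g ∈ lg := fun g => by simp [lg]
  have hs : Turing.TM0.Supports M {q | q ∈ ls} := by
    have : {q | q ∈ ls} = (S : Set Λ) := by ext q; simp [ls]
    rw [this]; exact hsup
  have hq : Set.InjOn iq {q | q ∈ ls} := fun a ha b hb h => (List.idxOf_inj ha).1 h
  have hg : Function.Injective ig := fun a b h => (List.idxOf_inj (hlg a)).1 h
  have hqB : ∀ q ∈ ls, iq q < ls.length + lg.length := fun q h => by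
    have := List.idxOf_lt_length_of_mem h
    show ls.idxOf q < _
    omega
  have hgB : ∀ g, ig g < ls.length + lg.length := fun g => by
    have := List.idxOf_lt_length_of_mem (hlg g)
    show lg.idxOf g < _
    omega
  let φ : ℕ → HQPlus := fun n => HQ.pexs (3 * (ls.length + lg.length))
    (HQ.mainF M ls lg iq ig (x :: y :: List.replicate n z))
  have hcl : ∀ n, (φ n).Closed := fun n => by
    show (φ n).free = ∅
    rw [HQ.free_pexs, HQ.closed_mainF]
  have hcomp : Computable fun n => f (Nat.pair HQ.K1.enc (φ n).enc) :=
    hf.comp (Primrec₂.natPair.comp (.const _) (HQ.primrec_mainF M ls lg iq ig x y z _)).to_comp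
  refine ComputablePred.computable_iff.2
    ⟨fun n => !f (Nat.pair HQ.K1.enc (φ n).enc), Primrec.not.to_comp.comp hcomp, ?_⟩
  funext n
  have h1 := hspec HQ.K1 (φ n) (hcl n)
  have h2 := HQ.reduction hs hlg hq hg hqB hgB (x :: y :: List.replicate n z)
  have h3 := h1.trans h2
  apply propext
  cases hb : f (Nat.pair HQ.K1.enc (φ n).enc) <;> simp [hb] at h3 ⊢ <;> exact h3
end
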